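/- Let m ∈ ℕ and α ∈ (0,1], and let U ⊆ ℝ^d be open. For a function f : U → ℝ the following are equivalent: (1) for every smooth curve c ∈ C^∞(ℝ, U) the composite f ∘ c belongs to C^{m,α}(ℝ); (2) f belongs to C^{m,α}(U). -/

import Mathlib

/-- Partial derivative of `f` in the `i`-th coordinate direction. -/
noncomputable def pd (d : ℕ) (i : Fin d) (f : EuclideanSpace ℝ (Fin d) → ℝ) :
    EuclideanSpace ℝ (Fin d) → ℝ :=
  fun x => fderiv ℝ f x (EuclideanSpace.single i 1)

/-- Iterated partial derivative `∂^γ f` for a multi-index `γ`. -/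
noncomputable def pdMulti (d : ℕ) (γ : Fin d → ℕ) (f : EuclideanSpace ℝ (Fin d) → ℝ) :
    EuclideanSpace ℝ (Fin d) → ℝ :=
  (List.finRange d).foldr (fun i g => (pd d i)^[γ i] g) f
/-- The local Hölder–Lipschitz class `C^{m,α}(U)` for `U ⊆ ℝ^d`: `C^m` functions on `U` all of
whose partial derivatives `∂^γ f` with `|γ| = m` are `α`-Hölder on every compact `K ⊆ U`. -/
def HolderClassOn (d m : ℕ) (α : ℝ) (f : EuclideanSpace ℝ (Fin d) → ℝ)
    (U : Set (EuclideanSpace ℝ (Fin d))) : Prop :=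
  ContDiffOn ℝ m f U ∧
    ∀ γ : Fin d → ℕ, (∑ i, γ i) = m →
      ∀ K : Set (EuclideanSpace ℝ (Fin d)), K ⊆ U → IsCompact K →
        ∃ C : ℝ, ∀ x h : EuclideanSpace ℝ (Fin d), x ∈ K → x + h ∈ K → h ≠ 0 →
          |pdMulti d γ f (x + h) - pdMulti d γ f x| ≤ C * ‖h‖ ^ α
/-- The local Hölder–Lipschitz class `C^{m,α}(ℝ)`: `C^m` functions whose `m`-th derivative is
locally `α`-Hölder. -/
def HolderClassR (m : ℕ) (α : ℝ) (f : ℝ → ℝ) : Prop :=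
  ContDiff ℝ m f ∧
    ∀ K : Set ℝ, IsCompact K →
      ∃ C : ℝ, ∀ x h : ℝ, x ∈ K → x + h ∈ K → h ≠ 0 →
        |iteratedDeriv m f (x + h) - iteratedDeriv m f x| ≤ C * |h| ^ α

section Helpers
open Filter Topology Asymptotics Set

section HolAt
variable {X : Type*} [NormedAddCommGroup X] {α : ℝ}

/-- local Hölder condition at a point -/
def HolAt (α : ℝ) (g : X → ℝ) (x : X) : Prop :=
  (fun p : X × X => g p.1 - g p.2) =O[𝓝 (x, x)] fun p => ‖p.1 - p.2‖ ^ α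

lemma HolAt.add {g k : X → ℝ} {x : X} (hg : HolAt α g x) (hk : HolAt α k x) :
    HolAt α (fun y => g y + k y) x := by
  refine (IsBigO.add hg hk).congr_left ?_
  intro p; ring

lemma HolAt.congr {g k : X → ℝ} {x : X} (hg : HolAt α g x) (h : g =ᶠ[𝓝 x] k) :
    HolAt α k x := by
  refine IsBigO.congr' hg ?_ EventuallyEq.rfl
  rw [nhds_prod_eq]
  filter_upwards [h.prod_mk h] with p hp
  rw [hp.1, hp.2]

lemma HolAt.mul {g k : X → ℝ} {x : X} (hg : HolAt α g x) (hk : HolAt α k x)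
    (cg : ContinuousAt g x) (ck : ContinuousAt k x) :
    HolAt α (fun y => g y * k y) x := by
  have h1 : (fun p : X × X => g p.1) =O[𝓝 (x, x)] (fun _ => (1 : ℝ)) := by
    have : ContinuousAt (fun p : X × X => g p.1) (x, x) :=
      ContinuousAt.comp (x := (x, x)) (f := Prod.fst) (g := g) cg continuousAt_fst
    exact this.isBigO_one ℝ
  have h2 : (fun p : X × X => k p.2) =O[𝓝 (x, x)] (fun _ => (1 : ℝ)) := by
    have : ContinuousAt (fun p : X × X => k p.2) (x, x) :=
      ContinuousAt.comp (x := (x, x)) (f := Prod.snd) (g := k) ck continuousAt_snd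
    exact this.isBigO_one ℝ
  have := (h1.mul hk).add (h2.mul hg)
  simp only [one_mul] at this
  refine this.congr_left ?_
  intro p; ring

lemma isBigO_rpow_of_one (hα : α ∈ Ioc (0 : ℝ) 1) (x : X) :
    (fun p : X × X => ‖p.1 - p.2‖) =O[𝓝 (x, x)] fun p => ‖p.1 - p.2‖ ^ α := by
  refine IsBigO.of_bound 1 ?_
  have hc : ContinuousAt (fun p : X × X => ‖p.1 - p.2‖) (x, x) := by fun_prop
  have : ∀ᶠ p in 𝓝 (x, x), ‖p.1 - p.2‖ < 1 := by
    refine hc.eventually_lt continuousAt_const ?_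
    simp
  filter_upwards [this] with p hp
  rw [one_mul, norm_norm, Real.norm_of_nonneg (by positivity)]
  exact Real.self_le_rpow_of_le_one (norm_nonneg _) hp.le hα.2

lemma HolAt.of_contDiffAt [NormedSpace ℝ X] {g : X → ℝ} {x : X} (hα : α ∈ Ioc (0 : ℝ) 1)
    (hg : ContDiffAt ℝ 1 g x) : HolAt α g x := by
  have h := (hg.hasStrictFDerivAt (by simp)).isBigO_sub
  exact h.norm_right.trans (isBigO_rpow_of_one hα x)

lemma HolAt.comp {Y : Type*} [NormedAddCommGroup Y] [NormedSpace ℝ Y] [NormedSpace ℝ X]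
    {g : X → ℝ} {c : Y → X} {y : Y} (hα : 0 ≤ α)
    (hg : HolAt α g (c y)) (hc : ContDiffAt ℝ 1 c y) : HolAt α (g ∘ c) y := by
  have h := (hc.hasStrictFDerivAt (by simp)).isBigO_sub
  have ht : Tendsto (fun p : Y × Y => (c p.1, c p.2)) (𝓝 (y, y)) (𝓝 (c y, c y)) := by
    have : ContinuousAt (fun p : Y × Y => (c p.1, c p.2)) (y, y) := by
      apply ContinuousAt.prodMk
      · exact ContinuousAt.comp (x := (y, y)) (f := Prod.fst) (g := c) hc.continuousAt continuousAt_fst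
      · exact ContinuousAt.comp (x := (y, y)) (f := Prod.snd) (g := c) hc.continuousAt continuousAt_snd
    exact this
  have h1 := IsBigO.comp_tendsto hg ht
  refine h1.trans ?_
  exact (h.norm_norm).rpow hα (Eventually.of_forall fun p => norm_nonneg _)

lemma HolAt.continuousAt {g : X → ℝ} {x : X} (hα : 0 < α) (h : HolAt α g x) :
    ContinuousAt g x := by
  have ht : Tendsto (fun y => (y, x)) (𝓝 x) (𝓝 (x, x)) := by
    have : ContinuousAt (fun y => (y, x)) x := by fun_prop
    exact this
  have h1 := IsBigO.comp_tendsto h ht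
  have h2 : Tendsto (fun y => ‖y - x‖ ^ α) (𝓝 x) (𝓝 0) := by
    have : ContinuousAt (fun y => ‖y - x‖ ^ α) x :=
      ContinuousAt.rpow_const (by fun_prop) (Or.inr hα.le)
    have h3 := this.tendsto
    simpa [Real.zero_rpow hα.ne'] using h3
  have h4 := h1.trans_tendsto h2
  rw [ContinuousAt, ← tendsto_sub_nhds_zero_iff]
  exact h4

lemma HolAt.compact {g : X → ℝ} {K : Set X} (hα : 0 < α) (hK : IsCompact K)
    (h : ∀ x ∈ K, HolAt α g x) :
    ∃ C : ℝ, 0 ≤ C ∧ ∀ x ∈ K, ∀ y ∈ K, |g x - g y| ≤ C * ‖x - y‖ ^ α := by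
  have key : ∃ C : ℝ, 0 ≤ C ∧ ∀ p ∈ K ×ˢ K, |g p.1 - g p.2| ≤ C * ‖p.1 - p.2‖ ^ α := by
    refine IsCompact.induction_on (hK.prod hK)
      (p := fun S => ∃ C : ℝ, 0 ≤ C ∧ ∀ p ∈ S, |g p.1 - g p.2| ≤ C * ‖p.1 - p.2‖ ^ α)
      ⟨0, le_rfl, by simp⟩ ?_ ?_ ?_
    · rintro s t hst ⟨C, h0, hC⟩
      exact ⟨C, h0, fun p hp => hC p (hst hp)⟩
    · rintro s t ⟨C, h0, hC⟩ ⟨D, h0', hD⟩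
      refine ⟨max C D, le_max_of_le_left h0, ?_⟩
      rintro p (hp | hp)
      · exact (hC p hp).trans (by gcongr; exact le_max_left _ _)
      · exact (hD p hp).trans (by gcongr; exact le_max_right _ _)
    · rintro ⟨x, y⟩ ⟨hx, hy⟩
      by_cases hxy : x = y
      · subst hxy
        obtain ⟨C, hC0, hC⟩ := (h x hx).exists_nonneg
        refine ⟨_, mem_nhdsWithin_of_mem_nhds hC.bound, C, hC0, ?_⟩
        intro p hp
        have : ‖g p.1 - g p.2‖ ≤ C * ‖‖p.1 - p.2‖ ^ α‖ := hp
        rwa [Real.norm_eq_abs, Real.norm_of_nonneg (by positivity)] at this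
      · have hcx := (h x hx).continuousAt hα
        have hcy := (h y hy).continuousAt hα
        have c1 : ContinuousAt (fun p : X × X => |g p.1 - g p.2|) (x, y) := by
          have a1 : ContinuousAt (fun p : X × X => g p.1) (x, y) :=
            ContinuousAt.comp (x := (x, y)) (f := Prod.fst) (g := g) hcx continuousAt_fst
          have a2 : ContinuousAt (fun p : X × X => g p.2) (x, y) :=
            ContinuousAt.comp (x := (x, y)) (f := Prod.snd) (g := g) hcy continuousAt_snd
          exact (a1.sub a2).abs
        have hpos : 0 < ‖x - y‖ ^ α := Real.rpow_pos_of_pos (norm_pos_iff.2 (sub_ne_zero.2 hxy)) _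
        have c2 : ContinuousAt (fun p : X × X =>
            ((|g x - g y| + 1) / ‖x - y‖ ^ α) * ‖p.1 - p.2‖ ^ α) (x, y) :=
          continuousAt_const.mul (ContinuousAt.rpow_const (by fun_prop) (Or.inr hα.le))
        have : ∀ᶠ p in 𝓝 (x, y), |g p.1 - g p.2| <
            ((|g x - g y| + 1) / ‖x - y‖ ^ α) * ‖p.1 - p.2‖ ^ α := by
          refine c1.eventually_lt c2 ?_
          simp only
          rw [div_mul_cancel₀ _ hpos.ne']
          linarith
        refine ⟨_, mem_nhdsWithin_of_mem_nhds this, _, by positivity, fun p hp => le_of_lt hp⟩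
  obtain ⟨C, h0, hC⟩ := key
  exact ⟨C, h0, fun x hx y hy => hC (x, y) ⟨hx, hy⟩⟩

lemma HolAt.of_bound {g : X → ℝ} {x : X} {C : ℝ} {K : Set X} (hK : K ∈ 𝓝 x)
    (h : ∀ y ∈ K, ∀ z ∈ K, |g y - g z| ≤ C * ‖y - z‖ ^ α) : HolAt α g x := by
  refine IsBigO.of_bound C ?_
  rw [nhds_prod_eq]
  filter_upwards [prod_mem_prod hK hK] with p hp
  rw [Real.norm_eq_abs, Real.norm_of_nonneg (by positivity)]
  exact h _ hp.1 _ hp.2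

end HolAt

section HR
variable {α : ℝ}

/-- pointwise version of the class on the line -/
def HR (m : ℕ) (α : ℝ) (f : ℝ → ℝ) : Prop :=
  ContDiff ℝ m f ∧ ∀ t, HolAt α (iteratedDeriv m f) t

lemma hr_iff (m : ℕ) (hα : 0 < α) (f : ℝ → ℝ) : HolderClassR m α f ↔ HR m α f := by
  refine and_congr_right fun _ => ⟨fun h t => ?_, fun h K hK => ?_⟩
  · obtain ⟨C, hC⟩ := h (Metric.closedBall t 1) (isCompact_closedBall t 1)
    refine HolAt.of_bound (C := C) (Metric.closedBall_mem_nhds t one_pos) ?_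
    intro y hy z hz
    by_cases hyz : y = z
    · subst hyz
      simp [Real.zero_rpow hα.ne']
    · have := hC z (y - z) hz (by simpa using hy) (sub_ne_zero.2 hyz)
      simpa using this
  · obtain ⟨C, _, hC⟩ := HolAt.compact hα hK (fun x _ => h x)
    refine ⟨C, fun x h hx hxh _ => ?_⟩
    simpa using hC _ hxh _ hx

lemma HR.succ_iff (m : ℕ) (f : ℝ → ℝ) :
    HR (m + 1) α f ↔ Differentiable ℝ f ∧ HR m α (deriv f) := by
  unfold HR
  rw [iteratedDeriv_succ']
  have : ContDiff ℝ ((m + 1 : ℕ) : WithTop ℕ∞) f ↔ Differentiable ℝ f ∧ ContDiff ℝ m (deriv f) := by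
    have := contDiff_succ_iff_deriv (𝕜 := ℝ) (f := f) (n := (m : WithTop ℕ∞))
    push_cast
    rw [this]
    simp
  rw [this, and_assoc]

lemma HR.of_succ (hα : α ∈ Ioc (0 : ℝ) 1) {m : ℕ} {f : ℝ → ℝ} (h : HR (m + 1) α f) : HR m α f := by
  refine ⟨h.1.of_le (by exact_mod_cast Nat.le_succ m), fun t => ?_⟩
  apply HolAt.of_contDiffAt hα
  have : ContDiff ℝ 1 (iteratedDeriv m f) := by
    rw [iteratedDeriv_eq_iterate]
    have h1 := h.1
    rw [add_comm m 1] at h1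
    exact ContDiff.iterate_deriv' 1 m h1
  exact this.contDiffAt

lemma HR.of_le (hα : α ∈ Ioc (0 : ℝ) 1) {m n : ℕ} (hmn : n ≤ m) {f : ℝ → ℝ} (h : HR m α f) :
    HR n α f := by
  induction hmn with
  | refl => exact h
  | step _ ih => exact ih (h.of_succ hα)

lemma HR.add {m : ℕ} {f g : ℝ → ℝ} (hf : HR m α f) (hg : HR m α g) :
    HR m α (fun t => f t + g t) := by
  refine ⟨hf.1.add hg.1, fun t => ?_⟩
  refine ((hf.2 t).add (hg.2 t)).congr (Eventually.of_forall fun s => ?_)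
  exact (iteratedDeriv_add hf.1.contDiffAt hg.1.contDiffAt).symm

lemma HR.of_contDiff (hα : α ∈ Ioc (0 : ℝ) 1) {m : ℕ} {f : ℝ → ℝ} (hf : ContDiff ℝ (⊤ : ℕ∞) f) :
    HR m α f := by
  refine ⟨hf.of_le (by exact_mod_cast le_top), fun t => ?_⟩
  apply HolAt.of_contDiffAt hα
  rw [iteratedDeriv_eq_iterate]
  have h1 : ContDiff ℝ ((1 + m : ℕ) : WithTop ℕ∞) f := hf.of_le (by exact_mod_cast le_top)
  exact (ContDiff.iterate_deriv' 1 m h1).contDiffAt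

lemma HR.sum (hα : α ∈ Ioc (0 : ℝ) 1) {m : ℕ} {ι : Type*} (s : Finset ι) {f : ι → ℝ → ℝ}
    (hf : ∀ i ∈ s, HR m α (f i)) : HR m α (fun t => ∑ i ∈ s, f i t) := by
  classical
  induction s using Finset.induction_on with
  | empty => simpa using HR.of_contDiff hα contDiff_const
  | insert a s ha ih =>
    simp only [Finset.sum_insert ha]
    exact (hf a (by simp)).add (ih fun i hi => hf i (by simp [hi]))

lemma HR.mul (hα : α ∈ Ioc (0 : ℝ) 1) {m : ℕ} {f g : ℝ → ℝ} (hf : HR m α f)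
    (hg : ContDiff ℝ (⊤ : ℕ∞) g) : HR m α (fun t => f t * g t) := by
  induction m generalizing f g with
  | zero =>
    refine ⟨hf.1.mul (hg.of_le (by exact_mod_cast le_top)), fun t => ?_⟩
    have h1 := hf.2 t
    have h2 := (HR.of_contDiff hα (m := 0) hg).2 t
    rw [iteratedDeriv_zero] at *
    exact h1.mul h2 hf.1.continuous.continuousAt hg.continuous.continuousAt
  | succ m ih =>
    have hf0 := hf.of_succ hα
    rw [HR.succ_iff] at hf ⊢
    have hgd : Differentiable ℝ g := hg.differentiable (by simp)
    refine ⟨hf.1.mul hgd, ?_⟩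
    have : deriv (fun t => f t * g t) = fun t => deriv f t * g t + f t * deriv g t := by
      ext t
      exact deriv_fun_mul (hf.1 t) (hgd t)
    rw [this]
    refine (ih hf.2 hg).add (ih hf0 ?_)
    exact ((contDiff_infty_iff_deriv).1 hg).2

lemma HR.of_local {m : ℕ} {f : ℝ → ℝ} (h : ∀ t, ∃ g, HR m α g ∧ f =ᶠ[𝓝 t] g) : HR m α f := by
  constructor
  · rw [contDiff_iff_contDiffAt]
    intro t
    obtain ⟨g, hg, hfg⟩ := h t
    exact hg.1.contDiffAt.congr_of_eventuallyEq hfg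
  · intro t
    obtain ⟨g, hg, hfg⟩ := h t
    exact (hg.2 t).congr (hfg.symm.iteratedDeriv m)

end HR

section PD
variable {d : ℕ} {α : ℝ} {U : Set (EuclideanSpace ℝ (Fin d))}

/-- iterated partial derivatives along a list of coordinates -/
noncomputable def pdList (d : ℕ) (L : List (Fin d)) (f : EuclideanSpace ℝ (Fin d) → ℝ) :
    EuclideanSpace ℝ (Fin d) → ℝ :=
  L.foldr (pd d) f

lemma pdList_cons (i : Fin d) (L : List (Fin d)) (f : EuclideanSpace ℝ (Fin d) → ℝ) :
    pdList d (i :: L) f = pd d i (pdList d L f) := rfl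

lemma pdList_append (L L' : List (Fin d)) (f : EuclideanSpace ℝ (Fin d) → ℝ) :
    pdList d (L ++ L') f = pdList d L (pdList d L' f) := by
  simp [pdList, List.foldr_append]

lemma pdList_replicate (i : Fin d) (n : ℕ) (f : EuclideanSpace ℝ (Fin d) → ℝ) :
    pdList d (List.replicate n i) f = (pd d i)^[n] f := by
  induction n with
  | zero => rfl
  | succ n ih => rw [List.replicate_succ, pdList_cons, ih, Function.iterate_succ_apply']

lemma pdMulti_eq (γ : Fin d → ℕ) (f : EuclideanSpace ℝ (Fin d) → ℝ) :
    pdMulti d γ f = pdList d ((List.finRange d).flatMap fun i => List.replicate (γ i) i) f := by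
  unfold pdMulti
  generalize List.finRange d = L
  induction L with
  | nil => rfl
  | cons a L ih => rw [List.foldr_cons, ih, List.flatMap_cons, pdList_append, pdList_replicate]

lemma pd_congr (hU : IsOpen U) (i : Fin d) {f g : EuclideanSpace ℝ (Fin d) → ℝ}
    (h : EqOn f g U) : EqOn (pd d i f) (pd d i g) U := by
  intro x hx
  have : f =ᶠ[𝓝 x] g := h.eventuallyEq_of_mem (hU.mem_nhds hx)
  simp only [pd]
  rw [this.fderiv_eq]

lemma pdList_congr (hU : IsOpen U) (L : List (Fin d)) {f g : EuclideanSpace ℝ (Fin d) → ℝ}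
    (h : EqOn f g U) : EqOn (pdList d L f) (pdList d L g) U := by
  induction L with
  | nil => exact h
  | cons a L ih => exact pd_congr hU a ih

lemma pd_contDiffOn (hU : IsOpen U) (i : Fin d) {k : ℕ} {f : EuclideanSpace ℝ (Fin d) → ℝ}
    (h : ContDiffOn ℝ (k + 1 : ℕ) f U) : ContDiffOn ℝ k (pd d i f) U := by
  have := h.fderiv_of_isOpen hU (m := k) (by exact_mod_cast le_rfl)
  exact this.clm_apply contDiffOn_const

lemma pdList_contDiffOn (hU : IsOpen U) (L : List (Fin d)) {k : ℕ}
    {f : EuclideanSpace ℝ (Fin d) → ℝ}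
    (h : ContDiffOn ℝ (k + L.length : ℕ) f U) : ContDiffOn ℝ k (pdList d L f) U := by
  induction L generalizing k with
  | nil => simpa [pdList] using h
  | cons a L ih =>
    apply pd_contDiffOn hU
    apply ih
    convert h using 2
    simp; ring

lemma pd_swap (hU : IsOpen U) (i j : Fin d) {f : EuclideanSpace ℝ (Fin d) → ℝ}
    (h : ContDiffOn ℝ (2 : ℕ) f U) : EqOn (pd d i (pd d j f)) (pd d j (pd d i f)) U := by
  intro x hx
  have hf : ContDiffAt ℝ 2 f x := h.contDiffAt (hU.mem_nhds hx)
  have hs : IsSymmSndFDerivAt ℝ f x := hf.isSymmSndFDerivAt (by simp)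
  have hd : DifferentiableAt ℝ (fderiv ℝ f) x :=
    (hf.fderiv_right (m := 1) (by norm_num)).differentiableAt (by simp)
  have key : ∀ i j : Fin d, pd d i (pd d j f) x =
      fderiv ℝ (fderiv ℝ f) x (EuclideanSpace.single i 1) (EuclideanSpace.single j 1) := by
    intro i j
    unfold pd
    rw [fderiv_clm_apply hd (differentiableAt_const _)]
    simp
  rw [key, key]
  exact hs _ _

lemma pdList_perm (hU : IsOpen U) {L L' : List (Fin d)} (hL : L.Perm L')
    {f : EuclideanSpace ℝ (Fin d) → ℝ}
    (h : ContDiffOn ℝ (L.length : ℕ) f U) : EqOn (pdList d L f) (pdList d L' f) U := by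
  induction hL with
  | nil => exact fun _ _ => rfl
  | cons x _ ih =>
    apply pd_congr hU
    apply ih
    exact h.of_le (by simp)
  | swap x y l =>
    apply pd_swap hU
    apply pdList_contDiffOn hU
    convert h using 2
    simp; ring
  | trans h1 _ ih1 ih2 =>
    exact (ih1 h).trans (ih2 (by rwa [h1.length_eq] at h))

/-- list version of the class -/
def HE (d m : ℕ) (α : ℝ) (f : EuclideanSpace ℝ (Fin d) → ℝ)
    (U : Set (EuclideanSpace ℝ (Fin d))) : Prop :=
  ContDiffOn ℝ m f U ∧ ∀ L : List (Fin d), L.length = m → ∀ x ∈ U, HolAt α (pdList d L f) x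

lemma he_iff (hα : 0 < α) (hU : IsOpen U) (m : ℕ) (f : EuclideanSpace ℝ (Fin d) → ℝ) :
    HolderClassOn d m α f U ↔ HE d m α f U := by
  refine and_congr_right fun hf => ⟨fun h L hL x hx => ?_, fun h γ hγ K hKU hK => ?_⟩
  · set γ : Fin d → ℕ := fun i => L.count i with hγ
    have hp : L.Perm ((List.finRange d).flatMap fun i => List.replicate (γ i) i) := by
      rw [List.perm_iff_count]
      intro a
      rw [List.count_flatMap]
      simp only [Function.comp_def, List.count_replicate, hγ]
      rw [← Fin.sum_univ_def]
      simp
    have hs : ∑ i, γ i = m := by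
      rw [← hL, hp.length_eq, List.length_flatMap]
      simp [Fin.sum_univ_def]
    obtain ⟨r, hr, hrU⟩ := Metric.nhds_basis_closedBall.mem_iff.1 (hU.mem_nhds hx)
    obtain ⟨C, hC⟩ := h γ hs _ hrU (isCompact_closedBall x r)
    rw [pdMulti_eq] at hC
    refine HolAt.of_bound (C := C) (Metric.closedBall_mem_nhds x hr) ?_
    intro y hy z hz
    have he := pdList_perm hU hp (f := f) (by rwa [hL])
    rw [he (hrU hy), he (hrU hz)]
    by_cases hyz : y = z
    · subst hyz
      simp [Real.zero_rpow hα.ne']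
    · have := hC z (y - z) hz (by simpa using hy) (sub_ne_zero.2 hyz)
      simpa using this
  · obtain ⟨C, _, hC⟩ := HolAt.compact hα hK (g := pdMulti d γ f) (fun x hx => by
      rw [pdMulti_eq]
      apply h _ _ x (hKU hx)
      rw [← hγ, List.length_flatMap]
      simp [Fin.sum_univ_def])
    refine ⟨C, fun x h hx hxh _ => ?_⟩
    simpa using hC _ hxh _ hx

lemma HE.pd {m : ℕ} (hU : IsOpen U) {f : EuclideanSpace ℝ (Fin d) → ℝ} (h : HE d (m + 1) α f U)
    (i : Fin d) : HE d m α (pd d i f) U := by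
  refine ⟨pd_contDiffOn hU i h.1, fun L hL x hx => ?_⟩
  have : pdList d L (_root_.pd d i f) = pdList d (L ++ [i]) f := by
    rw [pdList_append]; rfl
  rw [this]
  exact h.2 _ (by simp [hL]) x hx

lemma HE.comp (hα : α ∈ Ioc (0 : ℝ) 1) (hU : IsOpen U) {m : ℕ}
    {f : EuclideanSpace ℝ (Fin d) → ℝ} (h : HE d m α f U)
    {c : ℝ → EuclideanSpace ℝ (Fin d)} (hc : ContDiff ℝ (⊤ : ℕ∞) c) (hcU : ∀ t, c t ∈ U) :
    HR m α (f ∘ c) := by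
  induction m generalizing f with
  | zero =>
    constructor
    · have := h.1.comp (t := U) (s := univ) (g := f) (f := c)
        (hc.of_le (by exact_mod_cast le_top)).contDiffOn (fun t _ => hcU t)
      exact contDiffOn_univ.1 this
    · intro t
      rw [iteratedDeriv_zero]
      exact HolAt.comp hα.1.le (h.2 [] rfl (c t) (hcU t))
        (hc.of_le (by exact_mod_cast le_top)).contDiffAt
  | succ m ih =>
    rw [HR.succ_iff]
    have hcd : ∀ t, HasDerivAt c (deriv c t) t := fun t =>
      (hc.differentiable (by simp) t).hasDerivAt
    have hfd : ∀ t, HasFDerivAt f (fderiv ℝ f (c t)) (c t) := fun t =>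
      ((h.1.contDiffAt (hU.mem_nhds (hcU t))).differentiableAt (by simp)).hasFDerivAt
    have hd : ∀ t, HasDerivAt (f ∘ c) (fderiv ℝ f (c t) (deriv c t)) t := fun t =>
      (hfd t).comp_hasDerivAt t (hcd t)
    refine ⟨fun t => (hd t).differentiableAt, ?_⟩
    have : deriv (f ∘ c) = fun t => ∑ i, (_root_.pd d i f ∘ c) t * deriv c t i := by
      ext t
      rw [(hd t).deriv]
      have e : deriv c t = ∑ i, deriv c t i • EuclideanSpace.single i (1 : ℝ) := by
        ext j
        simp [Finset.sum_apply, Pi.single_apply]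
      conv_lhs => rw [e]
      rw [map_sum]
      refine Finset.sum_congr rfl fun i _ => ?_
      rw [map_smul, smul_eq_mul, mul_comm]
      rfl
    rw [this]
    refine HR.sum hα _ fun i _ => HR.mul hα (ih (h.pd hU i)) ?_
    have h1 : ContDiff ℝ (⊤ : ℕ∞) (deriv c) := ((contDiff_infty_iff_deriv).1 hc).2
    exact (contDiff_euclidean.1 h1) i

end PD

section FD
variable {E : Type*} [NormedAddCommGroup E] [NormedSpace ℝ E]

/-- signed sum over subsets: mixed differences up to sign -/
noncomputable def DD (s : Finset ℕ) (h : ℕ → E) (F : E → ℝ) (x : E) : ℝ :=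
  ∑ S ∈ s.powerset, (-1) ^ S.card * F (x + ∑ j ∈ S, h j)

lemma DD_insert {s : Finset ℕ} {a : ℕ} (ha : a ∉ s) (h : ℕ → E) (F : E → ℝ) (x : E) :
    DD (insert a s) h F x = DD s h F x - DD s h F (x + h a) := by
  unfold DD
  rw [Finset.sum_powerset_insert ha, sub_eq_add_neg, ← Finset.sum_neg_distrib]
  congr 1
  refine Finset.sum_congr rfl fun S hS => ?_
  have haS : a ∉ S := fun h => ha (Finset.mem_powerset.1 hS h)
  rw [Finset.card_insert_of_notMem haS, Finset.sum_insert haS, add_assoc]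
  ring

lemma DD_zero {s : Finset ℕ} {k : ℕ} (hk : k ∈ s) {h : ℕ → E} (h0 : h k = 0) (F : E → ℝ) (x : E) :
    DD s h F x = 0 := by
  rw [← Finset.insert_erase hk, DD_insert (Finset.notMem_erase k s), h0]
  simp

lemma DD_const (m : ℕ) {h : ℕ → E} {w : E} (hw : ∀ j ∈ Finset.Icc 1 m, h j = w) (F : E → ℝ) (x : E) :
    DD (Finset.Icc 1 m) h F x = (-1) ^ m * (fwdDiff (w))^[m] F x := by
  induction m generalizing x with
  | zero => simp [DD]
  | succ m ih =>
    have e : Finset.Icc 1 (m + 1) = insert (m + 1) (Finset.Icc 1 m) := by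
      ext j; simp; omega
    have hw' : ∀ j ∈ Finset.Icc 1 m, h j = w := fun j hj => hw j (by rw [e]; simp [hj])
    rw [e, DD_insert (by simp), ih hw', ih hw', hw (m + 1) (by simp),
      Function.iterate_succ_apply']
    simp only [fwdDiff]
    ring

lemma DD_pure (n : ℕ) (h : ℕ → E) (F : E → ℝ) (x : E) :
    ∑ S ∈ (Finset.Icc 1 n).powerset,
      (-1) ^ S.card * (fwdDiff (-∑ j ∈ S, (1 / (j : ℝ)) • h j))^[n] F (x + ∑ j ∈ S, h j)
      = (-1) ^ n * DD (Finset.Icc 1 n) h F x := by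
  have h1 : ∀ k ∈ Finset.range (n + 1), DD (Finset.Icc 1 n) (fun j => (1 - k / (j : ℝ)) • h j) F x =
      if k = 0 then DD (Finset.Icc 1 n) h F x else 0 := by
    intro k hk
    split_ifs with hk0
    · simp [hk0]
    · have hk' : k ∈ Finset.Icc 1 n := by
        simp at hk ⊢; omega
      refine DD_zero hk' ?_ F x
      have : (k : ℝ) ≠ 0 := by exact_mod_cast hk0
      simp [div_self this]
  have h2 : ∑ k ∈ Finset.range (n + 1), ((-1 : ℝ) ^ (n - k) * n.choose k) *
      DD (Finset.Icc 1 n) (fun j => (1 - k / (j : ℝ)) • h j) F x =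
      (-1) ^ n * DD (Finset.Icc 1 n) h F x := by
    rw [Finset.sum_congr rfl fun k hk => by rw [h1 k hk]]
    simp
  rw [← h2]
  unfold DD
  simp_rw [fwdDiff_iter_eq_sum_shift, Finset.mul_sum]
  rw [Finset.sum_comm]
  refine Finset.sum_congr rfl fun k hk => Finset.sum_congr rfl fun S hS => ?_
  have : x + ∑ j ∈ S, h j + k • -∑ j ∈ S, (1 / (j : ℝ)) • h j =
      x + ∑ j ∈ S, (1 - (k : ℝ) / j) • h j := by
    rw [add_assoc]
    congr 1
    rw [← Nat.cast_smul_eq_nsmul ℝ, smul_neg, Finset.smul_sum, ← sub_eq_add_neg,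
      ← Finset.sum_sub_distrib]
    refine Finset.sum_congr rfl fun j _ => ?_
    rw [sub_smul, one_smul, smul_smul]
    congr 2
    ring
  rw [this]
  simp
  ring

lemma fwdDiff_mvt (m : ℕ) {φ : ℝ → ℝ} (hφ : ContDiff ℝ m φ) {s : ℝ} (hs : 0 < s) (a : ℝ) :
    ∃ ξ ∈ Icc a (a + m * s), (fwdDiff (s))^[m] φ a = s ^ m * iteratedDeriv m φ ξ := by
  induction m generalizing φ with
  | zero => exact ⟨a, by simp, by simp⟩
  | succ m ih =>
    have hφm : ContDiff ℝ m φ := hφ.of_le (by exact_mod_cast Nat.le_succ m)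
    have hsh : ContDiff ℝ m (fun t => φ (t + s)) := hφm.comp (contDiff_id.add contDiff_const)
    have hψ : ContDiff ℝ m (fwdDiff s φ) := hsh.sub hφm
    obtain ⟨ξ, hξ, h⟩ := ih hψ
    have e : iteratedDeriv m (fwdDiff s φ) ξ = iteratedDeriv m φ (ξ + s) - iteratedDeriv m φ ξ := by
      have : fwdDiff s φ = (fun t => φ (t + s)) - φ := rfl
      rw [this, iteratedDeriv_sub hsh.contDiffAt hφm.contDiffAt, iteratedDeriv_comp_add_const]
    have hdiff : Differentiable ℝ (iteratedDeriv m φ) :=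
      hφ.differentiable_iteratedDeriv m (by exact_mod_cast Nat.lt_succ_self m)
    obtain ⟨η, hη, h'⟩ := exists_deriv_eq_slope (iteratedDeriv m φ) (a := ξ) (b := ξ + s)
      (by linarith) hdiff.continuous.continuousOn hdiff.differentiableOn
    refine ⟨η, ⟨by linarith [hξ.1, hη.1], ?_⟩, ?_⟩
    · push_cast
      linarith [hξ.2, hη.2]
    · rw [Function.iterate_succ_apply, h, e, iteratedDeriv_succ, h', add_sub_cancel_left]
      field_simp
      ring

/-- `m`-th directional derivative -/
noncomputable def dirD (F : E → ℝ) (m : ℕ) (v x : E) : ℝ :=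
  iteratedDeriv m (fun t : ℝ => F (x + t • v)) 0

lemma iteratedDeriv_line (F : E → ℝ) (m : ℕ) (v x : E) (t : ℝ) :
    iteratedDeriv m (fun t : ℝ => F (x + t • v)) t = dirD F m v (x + t • v) := by
  unfold dirD
  have : (fun s : ℝ => F (x + t • v + s • v)) = fun s => (fun t : ℝ => F (x + t • v)) (t + s) := by
    ext s
    simp only [add_smul, add_assoc]
  rw [this, iteratedDeriv_comp_const_add m (fun t : ℝ => F (x + t • v)) t]
  simp

lemma fwdDiff_line (F : E → ℝ) (m : ℕ) (v x : E) (s : ℝ) :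
    (fwdDiff (s • v))^[m] F x = (fwdDiff (s))^[m] (fun t : ℝ => F (x + t • v)) 0 := by
  rw [fwdDiff_iter_eq_sum_shift, fwdDiff_iter_eq_sum_shift]
  refine Finset.sum_congr rfl fun k _ => ?_
  simp [mul_smul, ← Nat.cast_smul_eq_nsmul ℝ]

lemma fwdDiff_mvt_line {F : E → ℝ} {m : ℕ} (hF : ∀ x v, ContDiff ℝ m (fun t : ℝ => F (x + t • v)))
    {s : ℝ} (hs : 0 < s) (v x : E) :
    ∃ ξ, 0 ≤ ξ ∧ ξ ≤ m * s ∧ (fwdDiff (s • v))^[m] F x = s ^ m * dirD F m v (x + ξ • v) := by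
  obtain ⟨ξ, hξ, h⟩ := fwdDiff_mvt m (hF x v) hs 0
  refine ⟨ξ, hξ.1, by simpa using hξ.2, ?_⟩
  rw [fwdDiff_line, h, iteratedDeriv_line]

variable {α : ℝ}

lemma pure_bound {F : E → ℝ} {m : ℕ} (hα : 0 < α)
    (hF : ∀ x v, ContDiff ℝ m (fun t : ℝ => F (x + t • v)))
    {δ C : ℝ} (hC : 0 ≤ C)
    (hH : ∀ x v : E, ‖v‖ ≤ 1 → ∀ s : ℝ, |s| ≤ δ →
      |dirD F m v (x + s • v) - dirD F m v x| ≤ C * |s| ^ α)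
    {ρ : ℝ} (hρ : 0 < ρ) (hρδ : (m + 1) * ρ ≤ δ) {a : E} (ha : ‖a‖ ≤ ρ) (y : E) :
    |(fwdDiff (a))^[m + 1] F y| ≤ ρ ^ m * (C * ((m + 1) * ρ) ^ α) := by
  set u : E := ρ⁻¹ • a with hu
  have hau : a = ρ • u := by rw [hu, smul_smul, mul_inv_cancel₀ hρ.ne', one_smul]
  have hu1 : ‖u‖ ≤ 1 := by
    rw [hu, norm_smul, Real.norm_of_nonneg (by positivity), inv_mul_le_iff₀ hρ, mul_one]
    exact ha
  rw [Function.iterate_succ_apply', fwdDiff, hau]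
  obtain ⟨ξ, h0, h1, h2⟩ := fwdDiff_mvt_line hF hρ u (y + ρ • u)
  obtain ⟨ξ', h0', h1', h2'⟩ := fwdDiff_mvt_line hF hρ u y
  rw [h2, h2', ← mul_sub, abs_mul, abs_of_nonneg (by positivity : 0 ≤ ρ ^ m)]
  gcongr
  have e : y + ρ • u + ξ • u = (y + ξ' • u) + (ρ + ξ - ξ') • u := by module
  rw [e]
  have hb : |ρ + ξ - ξ'| ≤ (m + 1) * ρ := by
    rw [abs_le]; constructor <;> linarith
  refine (hH _ u hu1 _ (hb.trans hρδ)).trans ?_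
  gcongr

lemma dirD_holder {F : E → ℝ} {m : ℕ} (hα : 0 < α)
    (hF : ∀ x v, ContDiff ℝ m (fun t : ℝ => F (x + t • v)))
    {δ C : ℝ} (hδ : 0 < δ) (hC : 0 ≤ C)
    (hH : ∀ x v : E, ‖v‖ ≤ 1 → ∀ s : ℝ, |s| ≤ δ →
      |dirD F m v (x + s • v) - dirD F m v x| ≤ C * |s| ^ α) :
    ∃ δ' > 0, ∃ C' ≥ 0, ∀ x v h : E, ‖v‖ ≤ 1 → ‖h‖ ≤ δ' →
      |dirD F m v (x + h) - dirD F m v x| ≤ C' * ‖h‖ ^ α := by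
  set M : ℝ := m + 1 with hM
  have hM1 : 1 ≤ M := by simp [hM]
  refine ⟨δ / M ^ 2, by positivity,
    C * M ^ α + 2 ^ (m + 1) * (M ^ m * (C * (M * M) ^ α)) + C * M ^ α, by positivity, ?_⟩
  intro x v h hv hh
  rcases eq_or_ne h 0 with rfl | hh0
  · simp [Real.zero_rpow hα.ne']
  set s := ‖h‖ with hs
  have hs0 : 0 < s := norm_pos_iff.2 hh0
  have hsM : M * (M * s) ≤ δ := by
    rw [le_div_iff₀ (by positivity)] at hh
    nlinarith
  have hMs : M * s ≤ δ := by
    refine le_trans ?_ hsM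
    have : 0 ≤ M * s := by positivity
    nlinarith
  set k : ℕ → E := fun j => if j = m + 1 then h else s • v with hk
  have hkn : ∀ j, ‖k j‖ ≤ s := by
    intro j
    simp only [hk]
    split_ifs
    · exact le_rfl
    · rw [norm_smul, Real.norm_of_nonneg hs0.le]
      nlinarith
  have hmix : |DD (Finset.Icc 1 (m + 1)) k F x| ≤
      2 ^ (m + 1) * ((M * s) ^ m * (C * (M * (M * s)) ^ α)) := by
    have := DD_pure (m + 1) k F x
    have h1 : |DD (Finset.Icc 1 (m + 1)) k F x| =
        |(-1) ^ (m + 1) * DD (Finset.Icc 1 (m + 1)) k F x| := by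
      rw [abs_mul]; simp
    rw [h1, ← this]
    refine (Finset.abs_sum_le_sum_abs _ _).trans ?_
    have h2 : ∀ S ∈ (Finset.Icc 1 (m + 1)).powerset,
        |(-1) ^ S.card * (fwdDiff (-∑ j ∈ S, (1 / (j : ℝ)) • k j))^[m + 1] F (x + ∑ j ∈ S, k j)| ≤
        (M * s) ^ m * (C * (M * (M * s)) ^ α) := by
      intro S hS
      rw [abs_mul]
      simp only [abs_pow, abs_neg, abs_one, one_pow, one_mul]
      refine pure_bound hα hF hC hH (by positivity) hsM ?_ _
      rw [norm_neg]
      refine (norm_sum_le _ _).trans ?_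
      have : ∀ j ∈ S, ‖(1 / (j : ℝ)) • k j‖ ≤ s := by
        intro j hj
        have hj1 := Finset.mem_powerset.1 hS hj
        have hj2 : (1 : ℝ) ≤ j := by exact_mod_cast (Finset.mem_Icc.1 hj1).1
        rw [norm_smul, Real.norm_of_nonneg (by positivity)]
        calc 1 / (j : ℝ) * ‖k j‖ ≤ 1 * s := by
              gcongr
              · rw [div_le_one (by positivity)]; exact hj2
              · exact hkn j
          _ = s := one_mul s
      refine (Finset.sum_le_card_nsmul _ _ _ this).trans ?_
      rw [nsmul_eq_mul]
      gcongr
      have hc := Finset.card_le_card (Finset.mem_powerset.1 hS)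
      simp at hc
      rw [hM]
      exact_mod_cast hc
    refine (Finset.sum_le_card_nsmul _ _ _ h2).trans ?_
    rw [Finset.card_powerset, nsmul_eq_mul]
    simp
  have e : Finset.Icc 1 (m + 1) = insert (m + 1) (Finset.Icc 1 m) := by
    ext j; simp; omega
  have hc : ∀ j ∈ Finset.Icc 1 m, k j = s • v := by
    intro j hj
    have := (Finset.mem_Icc.1 hj).2
    simp only [hk]
    rw [if_neg (by omega)]
  have hkm : k (m + 1) = h := by simp [hk]
  rw [e, DD_insert (by simp), DD_const m hc, DD_const m hc, hkm, ← mul_sub, abs_mul] at hmix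
  simp only [abs_pow, abs_neg, abs_one, one_pow, one_mul] at hmix
  obtain ⟨ξ, h0, h1, h2⟩ := fwdDiff_mvt_line hF hs0 v (x + h)
  obtain ⟨ξ', h0', h1', h2'⟩ := fwdDiff_mvt_line hF hs0 v x
  rw [h2, h2', ← mul_sub, abs_mul, abs_of_nonneg (by positivity : 0 ≤ s ^ m)] at hmix
  have hmix' : |dirD F m v (x + ξ' • v) - dirD F m v (x + h + ξ • v)| ≤
      2 ^ (m + 1) * (M ^ m * (C * (M * M) ^ α)) * s ^ α := by
    have hsm : 0 < s ^ m := by positivity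
    refine le_of_mul_le_mul_left (hmix.trans (le_of_eq ?_)) hsm
    rw [mul_pow, ← mul_assoc M M s, Real.mul_rpow (by positivity) hs0.le]
    ring
  have hl : ∀ ζ : ℝ, 0 ≤ ζ → ζ ≤ m * s → ∀ y, |dirD F m v (y + ζ • v) - dirD F m v y| ≤
      C * M ^ α * s ^ α := by
    intro ζ hz hz' y
    have hb : |ζ| ≤ M * s := by
      rw [abs_of_nonneg hz, hM]; nlinarith
    refine (hH y v hv ζ (hb.trans hMs)).trans ?_
    rw [mul_assoc, ← Real.mul_rpow (by positivity) hs0.le]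
    gcongr
  have a1 := hl ξ h0 h1 (x + h)
  have a2 := hl ξ' h0' h1' x
  rw [abs_le] at *
  constructor <;> nlinarith

end FD

section Polar
variable {E : Type*} [NormedAddCommGroup E] [NormedSpace ℝ E]

lemma sum_sign_superset {n : ℕ} (r : Fin n → Fin n) :
    ∑ S ∈ (Finset.univ : Finset (Finset (Fin n))).filter (fun S => ∀ i, r i ∈ S),
      (-1 : ℝ) ^ S.card = if Function.Bijective r then (-1) ^ n else 0 := by
  classical
  split_ifs with hr
  · have : (Finset.univ : Finset (Finset (Fin n))).filter (fun S => ∀ i, r i ∈ S) =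
        {Finset.univ} := by
      ext S
      simp only [Finset.mem_filter, Finset.mem_univ, true_and, Finset.mem_singleton]
      constructor
      · intro h
        ext j
        obtain ⟨i, rfl⟩ := hr.2 j
        simp [h i]
      · rintro rfl; simp
    rw [this]
    simp
  · have hns : ¬ Function.Surjective r := fun h => hr (Finite.surjective_iff_bijective.1 h)
    simp only [Function.Surjective, not_forall, not_exists] at hns
    obtain ⟨k, hk⟩ := hns
    refine Finset.sum_involution (fun S _ => symmDiff S {k}) ?_ ?_ ?_ ?_
    · intro S hS
      by_cases hkS : k ∈ S
      · have : symmDiff S {k} = S.erase k := by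
          ext j; simp [Finset.mem_symmDiff]; grind
        rw [this]
        have h2 := Finset.card_erase_add_one hkS
        rw [← h2, pow_succ]
        ring
      · have : symmDiff S {k} = insert k S := by
          ext j; simp [Finset.mem_symmDiff]; grind
        rw [this, Finset.card_insert_of_notMem hkS, pow_succ]
        ring
    · intro S hS _ h
      have : k ∈ symmDiff S {k} ↔ k ∈ S := by rw [h]
      simp [Finset.mem_symmDiff] at this
    · intro S hS
      simp only [Finset.mem_filter, Finset.mem_univ, true_and] at hS ⊢
      intro i
      simp [Finset.mem_symmDiff, hS i, hk i]
    · intro S hS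
      simp

lemma polarization {n : ℕ} (A : ContinuousMultilinearMap ℝ (fun _ : Fin n => E) ℝ)
    (hA : ∀ (σ : Equiv.Perm (Fin n)) (h : Fin n → E), A (h ∘ σ) = A h) (h : Fin n → E) :
    ∑ S : Finset (Fin n), (-1 : ℝ) ^ S.card * A (fun _ => ∑ j ∈ S, h j) =
      (-1) ^ n * (n.factorial * A h) := by
  classical
  have e1 : ∀ S : Finset (Fin n), A (fun _ => ∑ j ∈ S, h j) =
      ∑ r : Fin n → Fin n, if ∀ i, r i ∈ S then A (h ∘ r) else 0 := by
    intro S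
    have := A.toMultilinearMap.map_sum_finset (α := fun _ => Fin n) (fun _ j => h j) (fun _ => S)
    simp only [ContinuousMultilinearMap.coe_coe] at this
    rw [this, ← Finset.sum_filter]
    refine Finset.sum_congr ?_ fun r _ => rfl
    ext r
    simp [Fintype.mem_piFinset]
  simp_rw [e1, Finset.mul_sum]
  rw [Finset.sum_comm]
  have e2 : ∀ r : Fin n → Fin n, (∑ S : Finset (Fin n), (-1 : ℝ) ^ S.card *
      (if ∀ i, r i ∈ S then A (h ∘ r) else 0)) =
      if Function.Bijective r then (-1) ^ n * A h else 0 := by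
    intro r
    have : (∑ S : Finset (Fin n), (-1 : ℝ) ^ S.card *
      (if ∀ i, r i ∈ S then A (h ∘ r) else 0)) = (∑ S ∈ (Finset.univ : Finset (Finset (Fin n))).filter (fun S => ∀ i, r i ∈ S),
      (-1 : ℝ) ^ S.card) * A (h ∘ r) := by
      rw [Finset.sum_mul, Finset.sum_filter]
      refine Finset.sum_congr rfl fun S _ => ?_
      split_ifs <;> simp
    rw [this, sum_sign_superset]
    split_ifs with hr
    · have := hA (Equiv.ofBijective r hr) h
      rw [Equiv.coe_ofBijective] at this
      rw [this]
    · simp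
  simp_rw [e2]
  rw [← Finset.sum_filter, Finset.sum_const, nsmul_eq_mul]
  have : ((Finset.univ : Finset (Fin n → Fin n)).filter Function.Bijective).card = n.factorial := by
    let e : {r : Fin n → Fin n // Function.Bijective r} ≃ Equiv.Perm (Fin n) :=
      ⟨fun r => Equiv.ofBijective r.1 r.2, fun σ => ⟨σ, σ.bijective⟩, fun r => by ext; rfl,
        fun σ => by ext; rfl⟩
    rw [← Fintype.card_subtype, Fintype.card_congr e, Fintype.card_perm]
    simp
  rw [this]
  ring

lemma polar_norm {n : ℕ} (A : ContinuousMultilinearMap ℝ (fun _ : Fin n => E) ℝ)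
    (hA : ∀ (σ : Equiv.Perm (Fin n)) (h : Fin n → E), A (h ∘ σ) = A h) {B : ℝ} (hB : 0 ≤ B)
    (h : ∀ v : E, ‖v‖ ≤ 1 → |A (fun _ => v)| ≤ B) : ‖A‖ ≤ 2 ^ n * (n ^ n * B) := by
  have hb : ∀ b : E, ‖b‖ ≤ n → |A (fun _ => b)| ≤ n ^ n * B := by
    intro b hb
    rcases Nat.eq_zero_or_pos n with hn | hn
    · subst hn
      have hb0 : ‖b‖ ≤ 1 := hb.trans (by simp)
      simpa using h b hb0
    · have hn0 : (0 : ℝ) < n := by exact_mod_cast hn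
      have e : (fun _ : Fin n => b) = fun i : Fin n => (n : ℝ) • ((n : ℝ)⁻¹ • b) := by
        ext i
        rw [smul_smul, mul_inv_cancel₀ hn0.ne', one_smul]
      rw [e, A.map_smul_univ (fun _ => (n : ℝ)) (fun _ => (n : ℝ)⁻¹ • b)]
      simp only [Finset.prod_const, Finset.card_univ, Fintype.card_fin, smul_eq_mul]
      rw [abs_mul, abs_of_nonneg (by positivity)]
      gcongr
      apply h
      rw [norm_smul, Real.norm_of_nonneg (by positivity), inv_mul_le_iff₀ hn0, mul_one]
      exact hb
  have hu : ∀ u : Fin n → E, (∀ i, ‖u i‖ ≤ 1) → |A u| ≤ 2 ^ n * (n ^ n * B) := by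
    intro u hu
    have hp := polarization A hA u
    have h1 : |A u| ≤ |(-1) ^ n * (n.factorial * A u)| := by
      rw [abs_mul, abs_mul]
      simp only [abs_pow, abs_neg, abs_one, one_pow, one_mul, Nat.abs_cast]
      have : (1 : ℝ) ≤ n.factorial := by exact_mod_cast Nat.one_le_iff_ne_zero.2 n.factorial_ne_zero
      nlinarith [abs_nonneg (A u)]
    refine h1.trans ?_
    rw [← hp]
    refine (Finset.abs_sum_le_sum_abs _ _).trans ?_
    have h2 : ∀ S ∈ (Finset.univ : Finset (Finset (Fin n))),
        |(-1 : ℝ) ^ S.card * A (fun _ => ∑ j ∈ S, u j)| ≤ n ^ n * B := by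
      intro S _
      rw [abs_mul]
      simp only [abs_pow, abs_neg, abs_one, one_pow, one_mul]
      apply hb
      refine (norm_sum_le _ _).trans ((Finset.sum_le_card_nsmul _ _ 1 fun j _ => hu j).trans ?_)
      have := Finset.card_le_univ S
      simp at this ⊢
      exact this
    refine (Finset.sum_le_card_nsmul _ _ _ h2).trans ?_
    rw [nsmul_eq_mul]
    simp
  refine ContinuousMultilinearMap.opNorm_le_bound (by positivity) fun w => ?_
  by_cases hw : ∃ i, w i = 0
  · obtain ⟨i, hi⟩ := hw
    rw [A.map_coord_zero i hi, norm_zero]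
    positivity
  · push Not at hw
    have e : w = fun i => ‖w i‖ • (‖w i‖⁻¹ • w i) := by
      ext i
      rw [smul_smul, mul_inv_cancel₀ (norm_ne_zero_iff.2 (hw i)), one_smul]
    have hn := hu (fun i => ‖w i‖⁻¹ • w i) fun i => by
      rw [norm_smul, norm_inv, norm_norm, inv_mul_cancel₀ (norm_ne_zero_iff.2 (hw i))]
    conv_lhs => rw [e]
    rw [A.map_smul_univ (fun i => ‖w i‖) (fun i => ‖w i‖⁻¹ • w i), norm_smul, mul_comm,
      Real.norm_eq_abs, norm_prod]
    simp only [norm_norm]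
    gcongr

end Polar

section Curve
variable {E : Type*} [NormedAddCommGroup E] [NormedSpace ℝ E] {α : ℝ}

lemma exists_bound_iteratedDeriv {p : ℝ → ℝ} (hp : ContDiff ℝ (⊤ : ℕ∞) p) (hc : HasCompactSupport p)
    (k : ℕ) : ∃ M : ℝ, ∀ u, |iteratedDeriv k p u| ≤ M := by
  have h1 : HasCompactSupport (iteratedFDeriv ℝ k p) := hc.iteratedFDeriv k
  have h2 : Continuous (iteratedFDeriv ℝ k p) :=
    hp.continuous_iteratedFDeriv (by exact_mod_cast le_top)
  obtain ⟨M, hM⟩ := h1.exists_bound_of_continuous h2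
  refine ⟨M, fun u => ?_⟩
  rw [← Real.norm_eq_abs, ← norm_iteratedFDeriv_eq_norm_iteratedDeriv]
  exact hM u

lemma iteratedDeriv_scale {p : ℝ → ℝ} {k : ℕ} (hp : ContDiff ℝ k p) (R τ t : ℝ) :
    iteratedDeriv k (fun t => p (R * (t - τ))) t = R ^ k * iteratedDeriv k p (R * (t - τ)) := by
  have h1 := congrFun (iteratedDeriv_comp_sub_const k (fun t => p (R * t)) τ) t
  rw [h1, iteratedDeriv_comp_const_mul hp]

lemma curve_exists [CompleteSpace E] (x0 : E) (a v : ℕ → E) (ha : ∀ n, ‖a n‖ ≤ 1)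
    (hv : ∀ n, ‖v n‖ ≤ 1) :
    ∃ c : ℝ → E, ContDiff ℝ (⊤ : ℕ∞) c ∧ ∀ (n : ℕ) (t : ℝ), |t - (1 / 2) ^ n| < (1 / 2) ^ n / 8 →
      c t = x0 + (1 / (n.factorial : ℝ)) • (a n + (8 * 2 ^ n * (t - (1 / 2) ^ n)) • v n) := by
  let ψ : ContDiffBump (0 : ℝ) := ⟨1, 2, one_pos, one_lt_two⟩
  let p : ℝ → ℝ := ψ
  let q : ℝ → ℝ := fun u => ψ u * u
  have hp : ContDiff ℝ (⊤ : ℕ∞) p := ψ.contDiff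
  have hq : ContDiff ℝ (⊤ : ℕ∞) q := hp.mul contDiff_id
  have hpc : HasCompactSupport p := ψ.hasCompactSupport
  have hqc : HasCompactSupport q := hpc.mul_right
  have hp1 : ∀ u, |u| ≤ 1 → p u = 1 := fun u hu =>
    ψ.one_of_mem_closedBall (by simpa [ψ] using hu)
  have hp0 : ∀ u, 2 ≤ |u| → p u = 0 := fun u hu =>
    ψ.zero_of_le_dist (by simpa [ψ] using hu)
  choose M hM using exists_bound_iteratedDeriv hp hpc
  choose N hN using exists_bound_iteratedDeriv hq hqc
  let P : ℕ → ℝ → ℝ := fun n t => p (8 * 2 ^ n * (t - (1 / 2) ^ n))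
  let Q : ℕ → ℝ → ℝ := fun n t => q (8 * 2 ^ n * (t - (1 / 2) ^ n))
  have hP : ∀ n, ContDiff ℝ (⊤ : ℕ∞) (P n) := fun n => hp.comp (by fun_prop)
  have hQ : ∀ n, ContDiff ℝ (⊤ : ℕ∞) (Q n) := fun n => hq.comp (by fun_prop)
  let T : ℕ → ℝ → E := fun n t => (1 / (n.factorial : ℝ)) • (P n t • a n + Q n t • v n)
  have hT : ∀ n, ContDiff ℝ (⊤ : ℕ∞) (T n) := fun n =>
    (((hP n).smul contDiff_const).add ((hQ n).smul contDiff_const)).const_smul _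
  have hb : ∀ (k n : ℕ) (t : ℝ), ‖iteratedFDeriv ℝ k (T n) t‖ ≤
      (M k + N k) * 8 ^ k * ((2 ^ k) ^ n / n.factorial) := by
    intro k n t
    have hk : ((k : ℕ∞) : WithTop ℕ∞) ≤ ((⊤ : ℕ∞) : WithTop ℕ∞) := by exact_mod_cast le_top
    have hPk : ContDiff ℝ k (P n) := (hP n).of_le (by exact_mod_cast le_top)
    have hQk : ContDiff ℝ k (Q n) := (hQ n).of_le (by exact_mod_cast le_top)
    rw [norm_iteratedFDeriv_eq_norm_iteratedDeriv]
    have e : iteratedDeriv k (T n) t = (1 / (n.factorial : ℝ)) •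
        (iteratedDeriv k (P n) t • a n + iteratedDeriv k (Q n) t • v n) := by
      have h1 : ContDiff ℝ k (fun t => P n t • a n) := hPk.smul contDiff_const
      have h2 : ContDiff ℝ k (fun t => Q n t • v n) := hQk.smul contDiff_const
      have e1 := iteratedDeriv_const_smul (x := t) (n := k)
        (f := (fun t => P n t • a n) + (fun t => Q n t • v n))
        (h1.add h2).contDiffAt (1 / (n.factorial : ℝ))
      have e2 := iteratedDeriv_add (x := t) h1.contDiffAt h2.contDiffAt
      have e3 := iteratedDeriv_smul_const (x := t) hPk.contDiffAt (a n)
      have e4 := iteratedDeriv_smul_const (x := t) hQk.contDiffAt (v n)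
      rw [e2, e3, e4] at e1
      exact e1
    rw [e, iteratedDeriv_scale (hp.of_le (by exact_mod_cast le_top)),
      iteratedDeriv_scale (hq.of_le (by exact_mod_cast le_top)), norm_smul]
    have hR : (0 : ℝ) ≤ (8 * 2 ^ n) ^ k := by positivity
    have b1 : ‖((8 * 2 ^ n) ^ k * iteratedDeriv k p (8 * 2 ^ n * (t - (1 / 2) ^ n))) • a n‖ ≤
        (8 * 2 ^ n) ^ k * M k := by
      rw [norm_smul, norm_mul, Real.norm_of_nonneg hR, Real.norm_eq_abs]
      have h1 := hM k (8 * 2 ^ n * (t - (1 / 2) ^ n))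
      have h2 := (abs_nonneg _).trans h1
      calc _ ≤ (8 * 2 ^ n) ^ k * M k * 1 := by gcongr; exact ha n
        _ = _ := mul_one _
    have b2 : ‖((8 * 2 ^ n) ^ k * iteratedDeriv k q (8 * 2 ^ n * (t - (1 / 2) ^ n))) • v n‖ ≤
        (8 * 2 ^ n) ^ k * N k := by
      rw [norm_smul, norm_mul, Real.norm_of_nonneg hR, Real.norm_eq_abs]
      have h1 := hN k (8 * 2 ^ n * (t - (1 / 2) ^ n))
      have h2 := (abs_nonneg _).trans h1
      calc _ ≤ (8 * 2 ^ n) ^ k * N k * 1 := by gcongr; exact hv n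
        _ = _ := mul_one _
    rw [Real.norm_of_nonneg (by positivity)]
    calc _ ≤ (1 / (n.factorial : ℝ)) * ((8 * 2 ^ n) ^ k * M k + (8 * 2 ^ n) ^ k * N k) := by
            gcongr
            exact (norm_add_le _ _).trans (add_le_add b1 b2)
      _ = _ := by rw [mul_pow, ← pow_mul, ← pow_mul, mul_comm n k]; ring
  refine ⟨fun t => x0 + ∑' n, T n t, ?_, ?_⟩
  · refine contDiff_const.add ?_
    refine contDiff_tsum (v := fun k n => (M k + N k) * 8 ^ k * ((2 ^ k) ^ n / n.factorial))
      hT (fun k _ => ?_) (fun k n t _ => hb k n t)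
    exact (Real.summable_pow_div_factorial (2 ^ k)).mul_left _
  · intro n t ht
    have hz : ∀ k, k ≠ n → T k t = 0 := by
      intro k hk
      have hfar : 2 ≤ |8 * 2 ^ k * (t - (1 / 2) ^ k)| := by
        have e2 : (2 : ℝ) ^ k * (1 / 2) ^ k = 1 := by rw [← mul_pow]; norm_num
        have hkp : (0 : ℝ) < 2 ^ k := by positivity
        have hk2 : (0 : ℝ) < (1 / 2) ^ k := by positivity
        have hn2 : (0 : ℝ) < (1 / 2) ^ n := by positivity
        have hd : (1 / 2 : ℝ) ^ k / 4 ≤ |t - (1 / 2) ^ k| := by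
          rcases lt_or_gt_of_ne hk with h | h
          · have : (1 / 2 : ℝ) ^ n ≤ (1 / 2) ^ (k + 1) :=
              pow_le_pow_of_le_one (by norm_num) (by norm_num) h
            rw [pow_succ] at this
            rw [abs_lt] at ht
            rw [le_abs]
            right
            linarith
          · have : (1 / 2 : ℝ) ^ k ≤ (1 / 2) ^ (n + 1) :=
              pow_le_pow_of_le_one (by norm_num) (by norm_num) h
            rw [pow_succ] at this
            rw [abs_lt] at ht
            rw [le_abs]
            left
            linarith
        rw [abs_mul, abs_of_pos (by positivity)]
        calc (2 : ℝ) = 8 * 2 ^ k * ((1 / 2) ^ k / 4) := by linear_combination (-2) * e2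
          _ ≤ _ := by gcongr
      simp only [T, P, Q, q]
      have : ψ (8 * 2 ^ k * (t - (1 / 2) ^ k)) = 0 := hp0 _ hfar
      have h' : p (8 * 2 ^ k * (t - (1 / 2) ^ k)) = 0 := this
      rw [this, h']
      simp
    have hone : ψ (8 * 2 ^ n * (t - (1 / 2) ^ n)) = 1 := by
      apply hp1
      have e2 : (2 : ℝ) ^ n * (1 / 2) ^ n = 1 := by rw [← mul_pow]; norm_num
      rw [abs_mul, abs_of_pos (by positivity)]
      calc _ ≤ 8 * 2 ^ n * ((1 / 2 : ℝ) ^ n / 8) := by gcongr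
        _ = 1 := by linear_combination e2
    simp only
    rw [tsum_eq_single n hz]
    have h' : p (8 * 2 ^ n * (t - (1 / 2) ^ n)) = 1 := hone
    simp only [T, P, Q, q]
    rw [hone, h', one_smul, one_mul]

lemma line_local [CompleteSpace E] {F : E → ℝ} {m : ℕ} (hα : 0 < α)
    (hF : ∀ c : ℝ → E, ContDiff ℝ (⊤ : ℕ∞) c → HolderClassR m α (F ∘ c)) (x0 : E) :
    ∃ δ > 0, ∃ C ≥ 0, ∀ x ∈ Metric.ball x0 δ, ∀ v : E, ‖v‖ ≤ 1 → ∀ s : ℝ, |s| ≤ δ →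
      |dirD F m v (x + s • v) - dirD F m v x| ≤ C * |s| ^ α := by
  by_contra! hcon
  have hlam : ∀ n : ℕ, (0 : ℝ) < 1 / (n.factorial : ℝ) := fun n => by positivity
  set lam : ℕ → ℝ := fun n => 1 / (n.factorial : ℝ) with hlamdef
  set σ : ℕ → ℝ := fun n => lam n * (8 * 2 ^ n) with hσdef
  have hσ : ∀ n, 0 < σ n := fun n => mul_pos (hlam n) (by positivity)
  choose x hx v hv s hs hbig using fun n : ℕ => hcon (lam n / 2) (half_pos (hlam n))
    (n * ((σ n) ^ m)⁻¹ * ((σ n) ^ α)⁻¹)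
    (by have := hσ n; positivity)
  obtain ⟨c, hc, hcn⟩ := curve_exists x0 (fun n => (lam n)⁻¹ • (x n - x0)) v (by
    intro n
    rw [norm_smul, Real.norm_of_nonneg (inv_nonneg.2 (hlam n).le), inv_mul_le_iff₀ (hlam n),
      mul_one, ← dist_eq_norm]
    have := hx n
    rw [Metric.mem_ball] at this
    linarith [hlam n]) hv
  have hcurve : ∀ n t, |t - (1 / 2) ^ n| < (1 / 2) ^ n / 8 →
      c t = x n + (σ n * (t - (1 / 2) ^ n)) • v n := by
    intro n t ht
    rw [hcn n t ht]
    change x0 + lam n • _ = _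
    rw [smul_add, smul_smul, mul_inv_cancel₀ (hlam n).ne', one_smul, smul_smul, hσdef]
    simp only
    rw [← mul_assoc (lam n)]
    abel
  have hder : ∀ n t, |t - (1 / 2) ^ n| < (1 / 2) ^ n / 8 → iteratedDeriv m (F ∘ c) t =
      σ n ^ m * dirD F m (v n) (x n + (σ n * (t - (1 / 2) ^ n)) • v n) := by
    intro n t ht
    have hev : F ∘ c =ᶠ[𝓝 t] fun t => (fun r => F (x n + r • v n)) (σ n * (t - (1 / 2) ^ n)) := by
      have ho : IsOpen {t : ℝ | |t - (1 / 2) ^ n| < (1 / 2) ^ n / 8} :=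
        isOpen_lt (by fun_prop) continuous_const
      filter_upwards [ho.mem_nhds ht] with t' ht'
      simp only [Function.comp]
      rw [hcurve n t' ht']
    rw [hev.iteratedDeriv_eq]
    have hl : ContDiff ℝ m (fun r : ℝ => F (x n + r • v n)) :=
      (hF (fun r => x n + r • v n) (by fun_prop)).1
    rw [iteratedDeriv_scale hl, iteratedDeriv_line]
  obtain ⟨C, hC⟩ := (hF c hc).2 (Icc (-2) 2) isCompact_Icc
  obtain ⟨n, hn⟩ := exists_nat_ge C
  have hsn : s n ≠ 0 := by
    intro h0
    have := hbig n
    rw [h0] at this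
    simp [Real.zero_rpow hα.ne'] at this
  have hpow : (0 : ℝ) < (1 / 2) ^ n := by positivity
  have hpow1 : (1 / 2 : ℝ) ^ n ≤ 1 := pow_le_one₀ (by norm_num) (by norm_num)
  have hsig : |s n / σ n| < (1 / 2) ^ n / 8 := by
    rw [abs_div, abs_of_pos (hσ n), div_lt_iff₀ (hσ n)]
    have e2 : (2 : ℝ) ^ n * (1 / 2) ^ n = 1 := by rw [← mul_pow]; norm_num
    have : (1 / 2 : ℝ) ^ n / 8 * σ n = lam n := by
      simp only [hσdef]
      linear_combination (lam n) * e2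
    rw [this]
    linarith [hs n, hlam n]
  have h1 := hC ((1 / 2) ^ n) (s n / σ n) ⟨by linarith, by linarith⟩
    (by rw [abs_lt] at hsig; constructor <;> linarith) (div_ne_zero hsn (hσ n).ne')
  rw [hder n _ (by simpa using hsig), hder n _ (by simpa using hpow)] at h1
  simp only [add_sub_cancel_left, sub_self, mul_zero, zero_smul, add_zero] at h1
  rw [mul_div_cancel₀ _ (hσ n).ne', ← mul_sub, abs_mul, abs_of_pos (pow_pos (hσ n) m), abs_div,
    abs_of_pos (hσ n), Real.div_rpow (abs_nonneg _) (hσ n).le] at h1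
  have h2 := mul_lt_mul_of_pos_left (hbig n) (pow_pos (hσ n) m)
  have hA : 0 < |s n| ^ α := Real.rpow_pos_of_pos (abs_pos.2 hsn) _
  have hB : 0 < (σ n) ^ α := Real.rpow_pos_of_pos (hσ n) _
  have hpm := pow_pos (hσ n) m
  have h3 : σ n ^ m * (n * (σ n ^ m)⁻¹ * (σ n ^ α)⁻¹ * |s n| ^ α) = n * (|s n| ^ α / σ n ^ α) := by
    field_simp
  rw [h3] at h2
  have h4 := h2.trans_le h1
  have h5 : 0 < |s n| ^ α / σ n ^ α := by positivity
  have := lt_of_mul_lt_mul_right h4 h5.le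
  linarith

lemma dirD_zero {F : E → ℝ} {m : ℕ} {x v : E} (hx : x ∉ tsupport F) : dirD F m v x = 0 := by
  unfold dirD
  have h : F =ᶠ[𝓝 x] 0 := notMem_tsupport_iff_eventuallyEq.1 hx
  have ht : Tendsto (fun t : ℝ => x + t • v) (𝓝 0) (𝓝 x) := by
    have : ContinuousAt (fun t : ℝ => x + t • v) 0 := by fun_prop
    simpa [ContinuousAt] using this
  have h2 : (fun t : ℝ => F (x + t • v)) =ᶠ[𝓝 0] fun _ => 0 := ht.eventually h
  rw [h2.iteratedDeriv_eq]
  simp [iteratedDeriv_const]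

lemma line_global [FiniteDimensional ℝ E] {F : E → ℝ} {m : ℕ} (hα : 0 < α)
    (hF : ∀ c : ℝ → E, ContDiff ℝ (⊤ : ℕ∞) c → HolderClassR m α (F ∘ c))
    (hFc : HasCompactSupport F) :
    ∃ δ > 0, ∃ C ≥ 0, ∀ x v : E, ‖v‖ ≤ 1 → ∀ s : ℝ, |s| ≤ δ →
      |dirD F m v (x + s • v) - dirD F m v x| ≤ C * |s| ^ α := by
  have : CompleteSpace E := FiniteDimensional.complete ℝ E
  have : ProperSpace E := FiniteDimensional.proper_real E
  have hK : IsCompact (Metric.cthickening 1 (tsupport F)) := IsCompact.cthickening hFc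
  have key : ∃ δ > 0, ∃ C ≥ 0, ∀ x ∈ Metric.cthickening 1 (tsupport F), ∀ v : E, ‖v‖ ≤ 1 →
      ∀ s : ℝ, |s| ≤ δ → |dirD F m v (x + s • v) - dirD F m v x| ≤ C * |s| ^ α := by
    refine IsCompact.induction_on hK
      (p := fun S => ∃ δ > 0, ∃ C ≥ 0, ∀ x ∈ S, ∀ v : E, ‖v‖ ≤ 1 →
      ∀ s : ℝ, |s| ≤ δ → |dirD F m v (x + s • v) - dirD F m v x| ≤ C * |s| ^ α)
      ⟨1, one_pos, 0, le_rfl, by simp⟩ ?_ ?_ ?_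
    · rintro s t hst ⟨δ, hδ, C, h0, hC⟩
      exact ⟨δ, hδ, C, h0, fun p hp => hC p (hst hp)⟩
    · rintro s t ⟨δ, hδ, C, h0, hC⟩ ⟨δ', hδ', D, h0', hD⟩
      refine ⟨min δ δ', lt_min hδ hδ', max C D, le_max_of_le_left h0, ?_⟩
      rintro p (hp | hp) v hv r hr
      · exact (hC p hp v hv r (hr.trans (min_le_left _ _))).trans (by gcongr; exact le_max_left _ _)
      · exact (hD p hp v hv r (hr.trans (min_le_right _ _))).trans (by gcongr; exact le_max_right _ _)
    · intro x _
      obtain ⟨δ, hδ, C, h0, hC⟩ := line_local hα hF x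
      exact ⟨_, mem_nhdsWithin_of_mem_nhds (Metric.ball_mem_nhds x hδ), δ, hδ, C, h0, hC⟩
  obtain ⟨δ, hδ, C, h0, hC⟩ := key
  refine ⟨min δ 1, lt_min hδ one_pos, C, h0, fun x v hv s hs => ?_⟩
  by_cases hx : x ∈ Metric.cthickening 1 (tsupport F)
  · exact hC x hx v hv s (hs.trans (min_le_left _ _))
  · have h1 : x ∉ tsupport F := fun h => hx (Metric.self_subset_cthickening _ h)
    have h2 : x + s • v ∉ tsupport F := by
      intro h
      apply hx
      refine Metric.mem_cthickening_of_dist_le x _ 1 _ h ?_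
      rw [dist_eq_norm, sub_add_cancel_left, norm_neg, norm_smul, Real.norm_eq_abs]
      have := hs.trans (min_le_right _ _)
      nlinarith [norm_nonneg v, abs_nonneg s]
    rw [dirD_zero h1, dirD_zero h2]
    simp
    positivity

end Curve

section Sym
variable {E : Type*} [NormedAddCommGroup E] [NormedSpace ℝ E]

/-- iterated directional derivatives along a list -/
noncomputable def ddList (L : List E) (f : E → ℝ) : E → ℝ :=
  L.foldr (fun v g x => fderiv ℝ g x v) f

lemma ddList_cons (v : E) (L : List E) (f : E → ℝ) :
    ddList (v :: L) f = fun x => fderiv ℝ (ddList L f) x v := rfl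

lemma iteratedFDeriv_eq_ddList {n : ℕ} {f : E → ℝ} (hf : ContDiff ℝ n f) (h : Fin n → E) (x : E) :
    iteratedFDeriv ℝ n f x h = ddList (List.ofFn h) f x := by
  induction n generalizing x with
  | zero => simp [ddList]
  | succ n ih =>
    have hd : DifferentiableAt ℝ (iteratedFDeriv ℝ n f) x :=
      (hf.differentiable_iteratedFDeriv (by exact_mod_cast Nat.lt_succ_self n)).differentiableAt
    rw [hd.iteratedFDeriv_succ_apply_left', List.ofFn_succ, ddList_cons]
    congr 2
    funext y
    rw [ih (hf.of_le (by exact_mod_cast Nat.le_succ n))]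
    rfl

lemma dd_contDiff {k : ℕ} {f : E → ℝ} (h : ContDiff ℝ (k + 1 : ℕ) f) (v : E) :
    ContDiff ℝ k (fun x => fderiv ℝ f x v) := by
  have h1 : ContDiff ℝ k (fderiv ℝ f) := h.fderiv_right (by push_cast; exact le_rfl)
  exact h1.clm_apply contDiff_const

lemma ddList_contDiff (L : List E) {k : ℕ} {f : E → ℝ} (h : ContDiff ℝ (k + L.length : ℕ) f) :
    ContDiff ℝ k (ddList L f) := by
  induction L generalizing k with
  | nil => simpa [ddList] using h
  | cons v L ih =>
    rw [ddList_cons]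
    refine dd_contDiff (ih ?_) v
    convert h using 2
    simp; ring

lemma dd_swap {f : E → ℝ} (h : ContDiff ℝ (2 : ℕ) f) (v w : E) :
    (fun x => fderiv ℝ (fun y => fderiv ℝ f y w) x v) =
      (fun x => fderiv ℝ (fun y => fderiv ℝ f y v) x w) := by
  funext x
  have hs : IsSymmSndFDerivAt ℝ f x := h.contDiffAt.isSymmSndFDerivAt (by simp)
  have h1 : Differentiable ℝ (fderiv ℝ f) :=
    (h.fderiv_right (m := 1) (by norm_num)).differentiable (by norm_num)
  have e : ∀ a b : E, fderiv ℝ (fun y => fderiv ℝ f y b) x a = fderiv ℝ (fderiv ℝ f) x a b := by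
    intro a b
    rw [fderiv_clm_apply h1.differentiableAt (differentiableAt_const b)]
    simp
  rw [e, e]
  exact hs.eq v w

lemma ddList_perm {L L' : List E} (hL : L.Perm L') {f : E → ℝ}
    (h : ContDiff ℝ (L.length : ℕ) f) : ddList L f = ddList L' f := by
  induction hL with
  | nil => rfl
  | cons x _ ih =>
    rw [ddList_cons, ddList_cons, ih (h.of_le (by simp))]
  | swap x y l =>
    simp only [ddList_cons]
    refine dd_swap (ddList_contDiff l ?_) _ _
    convert h using 2
    simp; ring
  | trans h1 _ ih1 ih2 =>
    exact (ih1 h).trans (ih2 (by rwa [h1.length_eq] at h))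

lemma iteratedFDeriv_perm {n : ℕ} {f : E → ℝ} (hf : ContDiff ℝ n f) (x : E)
    (σ : Equiv.Perm (Fin n)) (h : Fin n → E) :
    iteratedFDeriv ℝ n f x (h ∘ σ) = iteratedFDeriv ℝ n f x h := by
  rw [iteratedFDeriv_eq_ddList hf, iteratedFDeriv_eq_ddList hf]
  exact congrFun (ddList_perm (Equiv.Perm.ofFn_comp_perm σ h) (by simpa using hf)) x

lemma iteratedFDeriv_diag {n : ℕ} {f : E → ℝ} (hf : ContDiff ℝ n f) (x v : E) :
    iteratedFDeriv ℝ n f x (fun _ => v) = dirD f n v x := by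
  have key : ∀ t : ℝ, iteratedDeriv n (fun t : ℝ => f (x + t • v)) t =
      iteratedFDeriv ℝ n f (x + t • v) (fun _ => v) := by
    induction n with
    | zero => intro t; simp
    | succ n ih =>
      intro t
      have hd : DifferentiableAt ℝ (iteratedFDeriv ℝ n f) (x + t • v) :=
        (hf.differentiable_iteratedFDeriv (by exact_mod_cast Nat.lt_succ_self n)).differentiableAt
      rw [iteratedDeriv_succ, funext (ih (hf.of_le (by exact_mod_cast Nat.le_succ n))),
        iteratedFDeriv_succ_apply_left]
      have hl : HasDerivAt (fun t : ℝ => x + t • v) v t := by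
        simpa using ((hasDerivAt_id t).smul_const v).const_add x
      have h1 := hd.hasFDerivAt.comp_hasDerivAt t hl
      have h2 := (ContinuousMultilinearMap.apply ℝ (fun _ : Fin n => E) ℝ
        (fun _ => v)).hasFDerivAt.comp_hasDerivAt t h1
      exact h2.deriv
  have := key 0
  simp only [zero_smul, add_zero] at this
  exact this.symm

end Sym

section Moll
open MeasureTheory Convolution
variable {E : Type*} [NormedAddCommGroup E] [NormedSpace ℝ E] [FiniteDimensional ℝ E]
  [MeasurableSpace E] [BorelSpace E] (μ : Measure E) [μ.IsAddHaarMeasure] {α : ℝ}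

lemma dirD_deriv {F : E → ℝ} {m j : ℕ} (hF : ∀ x v, ContDiff ℝ m (fun t : ℝ => F (x + t • v)))
    (hj : j < m) (x v : E) (t : ℝ) :
    HasDerivAt (fun t : ℝ => dirD F j v (x + t • v)) (dirD F (j + 1) v (x + t • v)) t := by
  have h := ((hF x v).differentiable_iteratedDeriv j (by exact_mod_cast hj)).differentiableAt
    (x := t)
  have h2 := h.hasDerivAt
  rw [← iteratedDeriv_succ, iteratedDeriv_line] at h2
  exact h2.congr_of_eventuallyEq (Eventually.of_forall fun s => (iteratedDeriv_line F j v x s).symm)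

lemma moll_dirD {F : E → ℝ} {m : ℕ} (hF : ∀ x v, ContDiff ℝ m (fun t : ℝ => F (x + t • v)))
    (hFc : HasCompactSupport F) (v : E) (hcont : ∀ j ≤ m, Continuous (dirD F j v))
    {ψ : E → ℝ} (hψ : Continuous ψ) (hψc : HasCompactSupport ψ) (j : ℕ) (hj : j ≤ m) (x : E) :
    dirD (ψ ⋆[ContinuousLinearMap.lsmul ℝ ℝ, μ] F) j v x =
      (ψ ⋆[ContinuousLinearMap.lsmul ℝ ℝ, μ] (dirD F j v)) x := by
  have key : ∀ t : ℝ, iteratedDeriv j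
      (fun t : ℝ => (ψ ⋆[ContinuousLinearMap.lsmul ℝ ℝ, μ] F) (x + t • v)) t =
      (ψ ⋆[ContinuousLinearMap.lsmul ℝ ℝ, μ] (dirD F j v)) (x + t • v) := by
    induction j with
    | zero =>
      intro t
      have : dirD F 0 v = F := by funext y; simp [dirD]
      rw [this]; simp
    | succ j ih =>
      intro t
      rw [iteratedDeriv_succ, funext (ih (by omega))]
      have hc1 := hcont j (by omega)
      have hc2 := hcont (j + 1) hj
      have hs2 : HasCompactSupport (dirD F (j + 1) v) :=
        HasCompactSupport.intro hFc fun y hy => dirD_zero hy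
      obtain ⟨B, hB⟩ := hs2.exists_bound_of_continuous hc2
      have hi := (hasDerivAt_integral_of_dominated_loc_of_deriv_le (μ := μ) (x₀ := t) (s := univ)
        (F := fun t y => ψ y * dirD F j v (x + t • v - y))
        (F' := fun t y => ψ y * dirD F (j + 1) v (x + t • v - y))
        (bound := fun y => ‖ψ y‖ * B) univ_mem
        (Eventually.of_forall fun t => (by fun_prop : Continuous _).aestronglyMeasurable)
        ((by fun_prop : Continuous _).integrable_of_hasCompactSupport hψc.mul_right)
        (by fun_prop : Continuous _).aestronglyMeasurable
        (ae_of_all _ fun y s _ => by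
          rw [norm_mul]
          gcongr
          exact hB _)
        ((by fun_prop : Continuous _).integrable_of_hasCompactSupport hψc.norm.mul_right)
        (ae_of_all _ fun y s _ => by
          refine HasDerivAt.const_mul _ ?_
          have := dirD_deriv hF (show j < m by omega) (x - y) v s
          convert this using 2 <;> congr 1 <;> abel)).2
      exact hi.deriv
  have := key 0
  simp only [zero_smul, add_zero] at this
  exact this

lemma contDiff_of_dirD {F : E → ℝ} {m : ℕ} (hα : 0 < α)
    (hF : ∀ x v, ContDiff ℝ m (fun t : ℝ => F (x + t • v)))
    (hFc : HasCompactSupport F) {δ C : ℝ} (hδ : 0 < δ) (hC : 0 ≤ C)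
    (hH : ∀ j ≤ m, ∀ x v h : E, ‖v‖ ≤ 1 → ‖h‖ ≤ δ →
      |dirD F j v (x + h) - dirD F j v x| ≤ C * ‖h‖ ^ α) : ContDiff ℝ m F := by
  obtain ⟨μ, hμ⟩ : ∃ μ : Measure E, μ.IsAddHaarMeasure := ⟨Measure.addHaar, inferInstance⟩
  have hcont : ∀ v : E, ‖v‖ ≤ 1 → ∀ j ≤ m, Continuous (dirD F j v) := by
    intro v hv j hj
    rw [continuous_iff_continuousAt]
    intro x
    have : HolAt α (dirD F j v) x := by
      refine HolAt.of_bound (C := C) (Metric.ball_mem_nhds x (half_pos hδ)) fun y hy z hz => ?_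
      have := hH j hj z v (y - z) hv (by
        rw [← dist_eq_norm]
        have := dist_triangle_right y z x
        rw [Metric.mem_ball] at hy hz
        linarith)
      simpa using this
    exact this.continuousAt hα
  have h0 : ∀ v : E, dirD F 0 v = F := fun v => by funext y; simp [dirD]
  have hFcont : Continuous F := by simpa [h0] using hcont 0 (by simp) 0 (Nat.zero_le _)
  let ε : ℕ → ℝ := fun n => δ * (1 / 2) ^ n
  have hε : ∀ n, 0 < ε n := fun n => by positivity
  have hεδ : ∀ n, ε n ≤ δ := fun n => by
    have : (1 / 2 : ℝ) ^ n ≤ 1 := pow_le_one₀ (by norm_num) (by norm_num)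
    simp only [ε]; nlinarith
  let φ : ℕ → ContDiffBump (0 : E) := fun n => ⟨ε n / 2, ε n, half_pos (hε n), half_lt_self (hε n)⟩
  let G : ℕ → E → ℝ := fun n => ((φ n).normed μ ⋆[ContinuousLinearMap.lsmul ℝ ℝ, μ] F)
  have hG : ∀ n, ContDiff ℝ m (G n) := fun n =>
    (φ n).hasCompactSupport_normed.contDiff_convolution_left (n := m) _ (φ n).contDiff_normed
      hFcont.locallyIntegrable
  have hGb : ∀ n, ∀ j ≤ m, ∀ x v : E, ‖v‖ ≤ 1 → |dirD (G n) j v x - dirD F j v x| ≤ C * (ε n) ^ α := by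
    intro n j hj x v hv
    simp only [G]
    rw [moll_dirD μ hF hFc v (hcont v hv) ((φ n).continuous_normed)
      (φ n).hasCompactSupport_normed j hj]
    have := (φ n).dist_normed_convolution_le (μ := μ) (g := dirD F j v) (x₀ := x)
      (ε := C * (ε n) ^ α) (hcont v hv j hj).aestronglyMeasurable (by
        intro y hy
        rw [Metric.mem_ball, dist_eq_norm] at hy
        have hy' : ‖y - x‖ ≤ ε n := hy.le
        have := hH j hj x v (y - x) hv (hy'.trans (hεδ n))
        rw [add_sub_cancel] at this
        rw [Real.dist_eq]
        refine this.trans ?_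
        gcongr)
    rwa [Real.dist_eq] at this
  have hε2 : ∀ n, ε (n + 1) ≤ ε n := fun n => by
    simp only [ε, pow_succ]
    have : (0 : ℝ) < δ * (1 / 2) ^ n := by positivity
    linarith
  have hbound : ∀ (j n : ℕ) (x : E), j ≤ m →
      ‖iteratedFDeriv ℝ j (fun y => G (n + 1) y - G n y) x‖ ≤
        2 ^ j * (j ^ j * (2 * C * (ε n) ^ α)) := by
    intro j n x hj
    have g1 : ContDiff ℝ j (G (n + 1)) := (hG _).of_le (by exact_mod_cast hj)
    have g2 : ContDiff ℝ j (G n) := (hG _).of_le (by exact_mod_cast hj)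
    have g3 : ContDiff ℝ j (fun y => G (n + 1) y - G n y) := g1.sub g2
    refine polar_norm _ (iteratedFDeriv_perm g3 x) (by have := hε n; positivity) ?_
    intro v hv
    have e : iteratedFDeriv ℝ j (fun y => G (n + 1) y - G n y) x =
        iteratedFDeriv ℝ j (G (n + 1)) x - iteratedFDeriv ℝ j (G n) x :=
      iteratedFDeriv_sub_apply g1.contDiffAt g2.contDiffAt
    rw [e, sub_apply, iteratedFDeriv_diag g1, iteratedFDeriv_diag g2]
    have b1 := hGb (n + 1) j hj x v hv
    have b2 := hGb n j hj x v hv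
    have b3 : C * ε (n + 1) ^ α ≤ C * ε n ^ α := by
      have := hε2 n
      have := hε (n + 1)
      gcongr
    have := abs_sub_le (dirD (G (n + 1)) j v x) (dirD F j v x) (dirD (G n) j v x)
    rw [abs_sub_comm (dirD F j v x)] at this
    linarith
  have hgeo : ∀ n, ε n ^ α = δ ^ α * ((1 / 2) ^ α) ^ n := fun n => by
    simp only [ε]
    rw [Real.mul_rpow hδ.le (by positivity), ← Real.rpow_natCast, ← Real.rpow_natCast,
      ← Real.rpow_mul (by norm_num), ← Real.rpow_mul (by norm_num), mul_comm (n : ℝ)]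
  have hr1 : (1 / 2 : ℝ) ^ α < 1 := Real.rpow_lt_one (by norm_num) (by norm_num) hα
  have hsumε : Summable fun n => ε n ^ α := by
    simp_rw [hgeo]
    exact (summable_geometric_of_lt_one (by positivity) hr1).mul_left _
  have hsum : ∀ j : ℕ, Summable fun n => (2 : ℝ) ^ j * ((j : ℝ) ^ j * (2 * C * (ε n) ^ α)) :=
    fun j => ((hsumε.mul_left _).mul_left _).mul_left _
  have hts : ContDiff ℝ m fun x => ∑' n, (G (n + 1) x - G n x) := by
    refine contDiff_tsum (N := (m : ℕ∞))
      (v := fun j n => (2 : ℝ) ^ j * ((j : ℝ) ^ j * (2 * C * (ε n) ^ α)))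
      (fun n => (hG (n + 1)).sub (hG n)) (fun j _ => hsum j) (fun j n x hj => ?_)
    exact hbound j n x (by exact_mod_cast hj)
  have hlim : ∀ x, Tendsto (fun n => G n x) atTop (𝓝 (F x)) := by
    intro x
    rw [tendsto_iff_dist_tendsto_zero]
    refine squeeze_zero (fun _ => dist_nonneg) (g := fun n => C * ε n ^ α) (fun n => ?_) ?_
    · have := hGb n 0 (Nat.zero_le _) x 0 (by simp)
      simpa [dirD, Real.dist_eq] using this
    · simpa using hsumε.tendsto_atTop_zero.const_mul C
  have hFe : F = fun x => G 0 x + ∑' n, (G (n + 1) x - G n x) := by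
    funext x
    have hs : Summable fun n => (G (n + 1) x - G n x) := by
      refine Summable.of_norm_bounded (hsum 0) fun n => ?_
      have := hbound 0 n x (Nat.zero_le _)
      rwa [norm_iteratedFDeriv_zero] at this
    have h1 := hs.hasSum.tendsto_sum_nat
    simp_rw [Finset.sum_range_sub (fun n => G n x)] at h1
    have h2 := tendsto_nhds_unique h1 ((hlim x).sub_const (G 0 x))
    rw [h2]; ring
  rw [hFe]
  exact (hG 0).add hts

end Moll

section Global
variable {E : Type*} [NormedAddCommGroup E] [NormedSpace ℝ E] [FiniteDimensional ℝ E] {α : ℝ}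

lemma global_boman {F : E → ℝ} {m : ℕ} (hα : α ∈ Ioc (0 : ℝ) 1)
    (hF : ∀ c : ℝ → E, ContDiff ℝ (⊤ : ℕ∞) c → HolderClassR m α (F ∘ c))
    (hFc : HasCompactSupport F) :
    ContDiff ℝ m F ∧ ∃ δ > 0, ∃ C ≥ 0, ∀ x h : E, ‖h‖ ≤ δ →
      ‖iteratedFDeriv ℝ m F (x + h) - iteratedFDeriv ℝ m F x‖ ≤ C * ‖h‖ ^ α := by
  borelize E
  have hFj : ∀ j ≤ m, ∀ c : ℝ → E, ContDiff ℝ (⊤ : ℕ∞) c → HolderClassR j α (F ∘ c) :=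
    fun j hj c hc => (hr_iff j hα.1 _).2 (((hr_iff m hα.1 _).1 (hF c hc)).of_le hα hj)
  have hl : ∀ j ≤ m, ∀ x v, ContDiff ℝ j (fun t : ℝ => F (x + t • v)) := fun j hj x v =>
    (hFj j hj (fun t => x + t • v) (by fun_prop)).1
  have hH : ∀ j ≤ m, ∃ δ > 0, ∃ C ≥ 0, ∀ x v h : E, ‖v‖ ≤ 1 → ‖h‖ ≤ δ →
      |dirD F j v (x + h) - dirD F j v x| ≤ C * ‖h‖ ^ α := by
    intro j hj
    obtain ⟨δ, hδ, C, hC, h⟩ := line_global hα.1 (hFj j hj) hFc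
    exact dirD_holder hα.1 (hl j hj) hδ hC h
  have hall : ∀ k ≤ m, ∃ δ > 0, ∃ C ≥ 0, ∀ j ≤ k, ∀ x v h : E, ‖v‖ ≤ 1 → ‖h‖ ≤ δ →
      |dirD F j v (x + h) - dirD F j v x| ≤ C * ‖h‖ ^ α := by
    intro k
    induction k with
    | zero =>
      intro hk
      obtain ⟨δ, hδ, C, hC, h⟩ := hH 0 hk
      refine ⟨δ, hδ, C, hC, fun j hj => ?_⟩
      obtain rfl : j = 0 := by omega
      exact h
    | succ k ih =>
      intro hk
      obtain ⟨δ, hδ, C, hC, h⟩ := hH (k + 1) hk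
      obtain ⟨δ', hδ', C', hC', h'⟩ := ih (by omega)
      refine ⟨min δ δ', lt_min hδ hδ', max C C', le_max_of_le_left hC, fun j hj x v r hv hr => ?_⟩
      rcases Nat.lt_or_ge j (k + 1) with hlt | hge
      · refine (h' j (by omega) x v r hv (hr.trans (min_le_right _ _))).trans ?_
        gcongr; exact le_max_right _ _
      · obtain rfl : j = k + 1 := by omega
        refine (h x v r hv (hr.trans (min_le_left _ _))).trans ?_
        gcongr; exact le_max_left _ _
  obtain ⟨δ, hδ, C, hC, h⟩ := hall m le_rfl
  have hcd : ContDiff ℝ m F :=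
    contDiff_of_dirD hα.1 (hl m le_rfl) hFc hδ hC h
  refine ⟨hcd, δ, hδ, 2 ^ m * (m ^ m * C), by positivity, fun x r hr => ?_⟩
  have := polar_norm (iteratedFDeriv ℝ m F (x + r) - iteratedFDeriv ℝ m F x)
    (fun σ k => by
      rw [sub_apply, sub_apply,
        iteratedFDeriv_perm hcd, iteratedFDeriv_perm hcd])
    (B := C * ‖r‖ ^ α) (by positivity) (fun v hv => by
      rw [sub_apply, iteratedFDeriv_diag hcd, iteratedFDeriv_diag hcd]
      exact h m le_rfl x v r hv hr)
  refine this.trans (le_of_eq ?_)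
  ring

end Global

section Final
variable {d : ℕ} {α : ℝ} {U : Set (EuclideanSpace ℝ (Fin d))}

lemma pdList_eq_ddList (L : List (Fin d)) (f : EuclideanSpace ℝ (Fin d) → ℝ) :
    pdList d L f = ddList (L.map fun i => EuclideanSpace.single i (1 : ℝ)) f := by
  induction L with
  | nil => rfl
  | cons i L ih => rw [pdList_cons, List.map_cons, ddList_cons, ih]; rfl

lemma pdList_holAt {m : ℕ} {F : EuclideanSpace ℝ (Fin d) → ℝ} (hF : ContDiff ℝ m F)
    {δ C : ℝ} (hδ : 0 < δ) (hC : ∀ x h : EuclideanSpace ℝ (Fin d), ‖h‖ ≤ δ →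
      ‖iteratedFDeriv ℝ m F (x + h) - iteratedFDeriv ℝ m F x‖ ≤ C * ‖h‖ ^ α)
    (L : List (Fin d)) (hL : L.length = m) (x : EuclideanSpace ℝ (Fin d)) :
    HolAt α (pdList d L F) x := by
  subst hL
  set b : Fin L.length → EuclideanSpace ℝ (Fin d) :=
    fun k => EuclideanSpace.single (L.get k) (1 : ℝ) with hb
  have hof : List.ofFn b = L.map fun i => EuclideanSpace.single i (1 : ℝ) := by
    rw [hb]
    conv_rhs => rw [← List.ofFn_get L]
    rw [List.map_ofFn]
    rfl
  have e : ∀ y, pdList d L F y = iteratedFDeriv ℝ L.length F y b := by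
    intro y
    rw [iteratedFDeriv_eq_ddList hF, pdList_eq_ddList, hof]
  refine HolAt.of_bound (C := C) (Metric.ball_mem_nhds x (half_pos hδ)) fun y hy z hz => ?_
  have h1 := hC z (y - z) (by
    rw [← dist_eq_norm]
    have := dist_triangle_right y z x
    rw [Metric.mem_ball] at hy hz
    linarith)
  rw [add_sub_cancel] at h1
  rw [e, e, ← sub_apply, ← Real.norm_eq_abs]
  refine (ContinuousMultilinearMap.le_opNorm _ _).trans ?_
  have : ∏ i, ‖b i‖ = 1 := Finset.prod_eq_one fun i _ => by simp [hb]
  rw [this, mul_one]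
  exact h1

/-- smooth truncation of a curve near a time -/
lemma curve_trunc {E : Type*} [NormedAddCommGroup E] [NormedSpace ℝ E] {c : ℝ → E}
    (hc : ContDiff ℝ (⊤ : ℕ∞) c) {V : Set E} (hV : IsOpen V) (t0 : ℝ) (h0 : c t0 ∈ V) :
    ∃ c' : ℝ → E, ContDiff ℝ (⊤ : ℕ∞) c' ∧ (∀ t, c' t ∈ V) ∧ c' =ᶠ[𝓝 t0] c := by
  obtain ⟨r, hr, hrV⟩ := Metric.isOpen_iff.1 hV _ h0
  obtain ⟨ε, hε, hεr⟩ := Metric.continuous_iff.1 hc.continuous t0 r hr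
  let ψ : ContDiffBump t0 := ⟨ε / 2, ε, half_pos hε, half_lt_self hε⟩
  refine ⟨fun t => c t0 + ψ t • (c t - c t0), ?_, fun t => hrV ?_, ?_⟩
  · exact contDiff_const.add (ψ.contDiff.smul (hc.sub contDiff_const))
  · rw [Metric.mem_ball, dist_eq_norm, add_sub_cancel_left, norm_smul,
      Real.norm_of_nonneg ψ.nonneg]
    by_cases ht : dist t t0 < ε
    · have := hεr t ht
      rw [dist_eq_norm] at this
      have h1 := ψ.le_one (x := t)
      have h2 := ψ.nonneg (x := t)
      nlinarith [norm_nonneg (c t - c t0)]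
    · rw [ψ.zero_of_le_dist (not_lt.1 ht), zero_mul]
      exact hr
  · filter_upwards [ψ.eventuallyEq_one] with t ht
    rw [ht]
    simp

lemma boman_local {m : ℕ} (hα : α ∈ Ioc (0 : ℝ) 1) (hU : IsOpen U)
    {f : EuclideanSpace ℝ (Fin d) → ℝ}
    (hf : ∀ c : ℝ → EuclideanSpace ℝ (Fin d), ContDiff ℝ (⊤ : ℕ∞) c → (∀ t, c t ∈ U) →
        HolderClassR m α (f ∘ c)) : HE d m α f U := by
  have key : ∀ x0 ∈ U, ContDiffAt ℝ m f x0 ∧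
      ∀ L : List (Fin d), L.length = m → HolAt α (pdList d L f) x0 := by
    intro x0 hx0
    obtain ⟨r, hr, hrU⟩ := Metric.isOpen_iff.1 hU _ hx0
    let χ : ContDiffBump x0 := ⟨r / 4, r / 2, by positivity, by linarith⟩
    have hsub : tsupport χ ⊆ U := by
      rw [χ.tsupport_eq]
      exact (Metric.closedBall_subset_ball (half_lt_self hr)).trans hrU
    set F : EuclideanSpace ℝ (Fin d) → ℝ := fun x => f x * χ x with hFdef
    have hFc : HasCompactSupport F := χ.hasCompactSupport.mul_left
    have hF : ∀ c : ℝ → EuclideanSpace ℝ (Fin d), ContDiff ℝ (⊤ : ℕ∞) c →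
        HolderClassR m α (F ∘ c) := by
      intro c hc
      rw [hr_iff m hα.1]
      refine HR.of_local fun t0 => ?_
      by_cases ht : c t0 ∈ tsupport χ
      · obtain ⟨c', hc', hcU, hcc⟩ := curve_trunc hc hU t0 (hsub ht)
        refine ⟨fun t => (f ∘ c') t * (χ ∘ c') t, ?_, ?_⟩
        · exact HR.mul hα ((hr_iff m hα.1 _).1 (hf c' hc' hcU)) (χ.contDiff.comp hc')
        · filter_upwards [hcc] with t ht
          simp [hFdef, ht]
      · refine ⟨fun _ => 0, HR.of_contDiff hα contDiff_const, ?_⟩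
        have h1 : (χ : EuclideanSpace ℝ (Fin d) → ℝ) =ᶠ[𝓝 (c t0)] 0 :=
          notMem_tsupport_iff_eventuallyEq.1 ht
        filter_upwards [hc.continuous.continuousAt.eventually h1] with t ht
        simp [hFdef, ht]
    obtain ⟨hcd, δ, hδ, C, -, hC⟩ := global_boman hα hF hFc
    have hball : Metric.ball x0 (r / 4) ∈ 𝓝 x0 := Metric.ball_mem_nhds x0 (by positivity)
    have heq : EqOn F f (Metric.ball x0 (r / 4)) := by
      intro y hy
      have : χ y = 1 := χ.one_of_mem_closedBall (Metric.ball_subset_closedBall hy)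
      simp [hFdef, this]
    refine ⟨?_, fun L hL => ?_⟩
    · exact hcd.contDiffAt.congr_of_eventuallyEq (heq.eventuallyEq_of_mem hball).symm
    · exact (pdList_holAt hcd hδ hC L hL x0).congr
        ((pdList_congr Metric.isOpen_ball L heq).eventuallyEq_of_mem hball)
  exact ⟨fun x hx => (key x hx).1.contDiffWithinAt, fun L hL x hx => (key x hx).2 L hL⟩

end Final

end Helpers

/-- **Boman's theorem (Theorem 1.2).** For `U ⊆ ℝ^d` open, `m ∈ ℕ`, `α ∈ (0,1]`, and
`f : U → ℝ`, `f ∘ c ∈ C^{m,α}(ℝ)` for every smooth curve `c : ℝ → U` iff `f ∈ C^{m,α}(U)`. -/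
theorem holder_testing_on_smooth_curves (d m : ℕ) (α : ℝ) (hα : α ∈ Set.Ioc (0 : ℝ) 1)
    (U : Set (EuclideanSpace ℝ (Fin d))) (hU : IsOpen U)
    (f : EuclideanSpace ℝ (Fin d) → ℝ) :
    (∀ c : ℝ → EuclideanSpace ℝ (Fin d), ContDiff ℝ (⊤ : ℕ∞) c → (∀ t, c t ∈ U) →
        HolderClassR m α (f ∘ c)) ↔
      HolderClassOn d m α f U := by
  refine ⟨fun h => (he_iff hα.1 hU m f).2 (boman_local hα hU h), fun h c hc hcU => ?_⟩
  exact (hr_iff m hα.1 _).2 (HE.comp hα hU ((he_iff hα.1 hU m f).1 h) hc hcU)
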